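/- For every N ≥ 1 the identity Σ_{τ ∈ {⇑,0,⇓}^N} P_τ(X)² = A_N(X²) holds in ℤ[X]. (Equivalently: the square norm of the supersymmetry singlet |Φ(x)⟩, whose components are the integer polynomials P_τ(x), equals the generating function A_N(x²) for the weighted enumeration of N×N alternating sign matrices with weight x² per entry −1.) -/

import Mathlib

open Matrix BigOperators Finset Polynomial

noncomputable section

/-- The 6×6 matrix ρ over ℤ[y] on ℂ²⊗ℂ³, basis `(ε, σ)`, ε ∈ {0=↑,1=↓}, σ ∈ {0=⇑,1=0,2=⇓}. -/
def rho : Matrix (Fin 2 × Fin 3) (Fin 2 × Fin 3) (Polynomial ℤ) :=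
  Matrix.of fun p p' =>
    if p = (0,0) ∧ p' = (0,0) then 1
    else if p = (0,1) ∧ p' = (1,0) then Polynomial.X
    else if p = (0,2) ∧ p' = (0,2) then -1
    else if p = (0,2) ∧ p' = (1,1) then Polynomial.X
    else if p = (1,0) ∧ p' = (0,1) then Polynomial.X
    else if p = (1,0) ∧ p' = (1,0) then -1
    else if p = (1,1) ∧ p' = (0,2) then Polynomial.X
    else if p = (1,2) ∧ p' = (1,2) then 1
    else 0

/-- ρ acting on the auxiliary ℂ² and the j-th site of `(ℂ³)^{⊗N}`. -/
def rhoAt {N : ℕ} (j : Fin N) :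
    Matrix (Fin 2 × (Fin N → Fin 3)) (Fin 2 × (Fin N → Fin 3)) (Polynomial ℤ) :=
  Matrix.of fun p p' =>
    rho (p.1, p.2 j) (p'.1, p'.2 j) * if ∀ k, k ≠ j → p.2 k = p'.2 k then 1 else 0

/-- The operator β = ⟨↑| ρ_{a,N} ⋯ ρ_{a,1} |↓⟩ on `(ℂ³)^{⊗N}`, with entries in ℤ[y]. -/
def betaMat (N : ℕ) : Matrix (Fin N → Fin 3) (Fin N → Fin 3) (Polynomial ℤ) :=
  Matrix.of fun σ τ =>
    ((((List.finRange N).reverse).map fun j => rhoAt j).prod :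
      Matrix (Fin 2 × (Fin N → Fin 3)) (Fin 2 × (Fin N → Fin 3)) (Polynomial ℤ)) (0, σ) (1, τ)

/-- The reference state `|∧⟩ = |⇑…⇑⟩`, with coefficients in ℤ[y]. -/
def vacP (N : ℕ) : (Fin N → Fin 3) → Polynomial ℤ := fun σ => if σ = fun _ => 0 then 1 else 0

/-- The component `⟨τ|β^N|∧⟩ ∈ ℤ[y]`. -/
def comp (N : ℕ) (τ : Fin N → Fin 3) : Polynomial ℤ :=
  ((betaMat N ^ N).mulVec (vacP N)) τ

/-- Translation of a {−1,0,1}-valued table `f : Fin N → Fin N → Fin 3` into an integer matrix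
(0 ↦ −1, 1 ↦ 0, 2 ↦ 1). -/
def toMat {N : ℕ} (f : Fin N → Fin N → Fin 3) : Matrix (Fin N) (Fin N) ℤ :=
  Matrix.of fun i j => (![-1, 0, 1] : Fin 3 → ℤ) (f i j)

/-- `A` is an alternating sign matrix: entries in {−1,0,1}, every row and column sums to 1,
and in every row and every column the nonzero entries alternate in sign. -/
def IsASM {N : ℕ} (A : Matrix (Fin N) (Fin N) ℤ) : Prop :=
  (∀ i j, A i j = -1 ∨ A i j = 0 ∨ A i j = 1) ∧
  (∀ i, ∑ j, A i j = 1) ∧ (∀ j, ∑ i, A i j = 1) ∧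
  (∀ i, ∀ j₁ j₂ : Fin N, j₁ < j₂ → A i j₁ ≠ 0 → A i j₂ ≠ 0 →
    (∀ k, j₁ < k → k < j₂ → A i k = 0) → A i j₂ = -A i j₁) ∧
  (∀ j, ∀ i₁ i₂ : Fin N, i₁ < i₂ → A i₁ j ≠ 0 → A i₂ j ≠ 0 →
    (∀ k, i₁ < k → k < i₂ → A k j = 0) → A i₂ j = -A i₁ j)

open scoped Classical in
/-- `A_N(t)`: the generating polynomial of N×N alternating sign matrices,
with weight `t^{μ(A)}` where `μ(A)` is the number of entries −1 of `A`. -/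
def asmPoly (N : ℕ) : Polynomial ℤ :=
  ∑ f ∈ Finset.univ.filter (fun f : Fin N → Fin N → Fin 3 => IsASM (toMat f)),
    Polynomial.X ^ (Finset.univ.filter (fun p : Fin N × Fin N => toMat f p.1 p.2 = -1)).card

/-! ### Chains of sites and their monodromy operators -/

/-- Local weights of a vertex with `d` states on the vertical edges: `L p s k t` is the weight of
`(aux, site) = (k, t) ↦ (p, s)`. -/
abbrev Wt (d : ℕ) : Type := Fin 2 → Fin d → Fin 2 → Fin d → ℝ

/-- States of a chain of `n` sites with `d` states each. -/
abbrev Sp (d n : ℕ) : Type := (Fin n → Fin d) → ℝ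

section Step

variable {d n : ℕ}

/-- The part of a state having a prescribed value at the first site. -/
def sliceAt (s : Fin d) : Sp d (n + 1) →ₗ[ℝ] Sp d n :=
  LinearMap.funLeft ℝ ℝ fun σ : Fin n → Fin d => (Fin.cons s σ : Fin (n + 1) → Fin d)

lemma sliceAt_apply (s : Fin d) (ψ : Sp d (n + 1)) (σ : Fin n → Fin d) :
    sliceAt s ψ σ = ψ (Fin.cons s σ) := rfl

lemma sliceAt_ext {ψ χ : Sp d (n + 1)} (h : ∀ s, sliceAt s ψ = sliceAt s χ) : ψ = χ := by
  funext σ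
  simpa [sliceAt_apply] using congrFun (h (σ 0)) (Fin.tail σ)

/-- Glue a state from its slices. -/
def glue (f : Fin d → Sp d n) : Sp d (n + 1) := fun σ => f (σ 0) (Fin.tail σ)

@[simp] lemma sliceAt_glue (f : Fin d → Sp d n) (s : Fin d) : sliceAt s (glue f) = f s := by
  funext σ
  simp [sliceAt_apply, glue]

/-- The monodromy obtained by adding a site in front of a given monodromy. -/
def step (L : Wt d) (X : Fin 2 → Fin 2 → Module.End ℝ (Sp d n)) (i k : Fin 2) :
    Module.End ℝ (Sp d (n + 1)) where
  toFun ψ := glue fun s => ∑ p, ∑ t, L p s k t • X i p (sliceAt t ψ)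
  map_add' ψ χ := sliceAt_ext fun s => by
    simp [Finset.sum_add_distrib]
  map_smul' a ψ := sliceAt_ext fun s => by
    simp [Finset.smul_sum, smul_smul, mul_comm]

@[simp] lemma sliceAt_step (L : Wt d) (X : Fin 2 → Fin 2 → Module.End ℝ (Sp d n)) (i k : Fin 2)
    (ψ : Sp d (n + 1)) (s : Fin d) :
    sliceAt s (step L X i k ψ) = ∑ p, ∑ t, L p s k t • X i p (sliceAt t ψ) :=
  sliceAt_glue (fun s => ∑ p, ∑ t, L p s k t • X i p (sliceAt t ψ)) s

lemma sliceAt_step_mul (L M : Wt d) (X Y : Fin 2 → Fin 2 → Module.End ℝ (Sp d n)) (i j k l : Fin 2)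
    (ψ : Sp d (n + 1)) (s : Fin d) :
    sliceAt s ((step L X i k * step M Y j l) ψ) =
      ∑ p, ∑ r, ∑ v, (∑ u, L p s k u * M r u l v) • (X i p * Y j r) (sliceAt v ψ) := by
  simp only [Module.End.mul_apply, sliceAt_step, map_sum, map_smul, Finset.smul_sum, smul_smul,
    Finset.sum_smul]
  refine Finset.sum_congr rfl fun p _ => ?_
  rw [Finset.sum_comm]
  refine Finset.sum_congr rfl fun r _ => ?_
  rw [Finset.sum_comm]

/-- The exchange relation of two monodromies. -/
def RTT {V : Type*} [AddCommGroup V] [Module ℝ V] (R : Fin 2 → Fin 2 → Fin 2 → Fin 2 → ℝ)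
    (X Y : Fin 2 → Fin 2 → Module.End ℝ V) : Prop :=
  ∀ i j k l, ∑ m, ∑ n, R i j m n • (X m k * Y n l) = ∑ m, ∑ n, R m n k l • (Y j n * X i m)

lemma RTT.step {R : Fin 2 → Fin 2 → Fin 2 → Fin 2 → ℝ} {L M : Wt d}
    {X Y : Fin 2 → Fin 2 → Module.End ℝ (Sp d n)} (h : RTT R X Y)
    (hLM : ∀ i j k l s v, ∑ m, ∑ n, R i j m n * ∑ u, L m s k u * M n u l v =
      ∑ m, ∑ n, R m n k l * ∑ u, M j s n u * L i u m v) :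
    RTT R (step L X) (step M Y) := by
  intro i j k l
  refine LinearMap.ext fun ψ => sliceAt_ext fun s => ?_
  simp only [LinearMap.sum_apply, LinearMap.smul_apply, map_sum, map_smul, sliceAt_step_mul]
  have h' : ∀ (p r : Fin 2) (w : Sp d n), ∑ m, ∑ n, R i j m n • (X m p * Y n r) w =
      ∑ m, ∑ n, R m n p r • (Y j n * X i m) w := fun p r w => by
    simpa only [LinearMap.sum_apply, LinearMap.smul_apply] using
      congrArg (fun T : Module.End ℝ (Sp d n) => T w) (h i j p r)
  calc ∑ m, ∑ n, R i j m n • ∑ p, ∑ r, ∑ v, (∑ u, L p s k u * M r u l v) •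
          (X m p * Y n r) (sliceAt v ψ)
      = ∑ v, ∑ p, ∑ r, (∑ u, L p s k u * M r u l v) •
          ∑ m, ∑ n, R i j m n • (X m p * Y n r) (sliceAt v ψ) := by
        simp only [Fin.sum_univ_two, Finset.smul_sum, Finset.sum_add_distrib, smul_add, smul_smul,
          mul_comm]
        abel
    _ = ∑ v, ∑ p, ∑ r, (∑ m, ∑ n, R p r m n * ∑ u, L m s k u * M n u l v) •
          (Y j r * X i p) (sliceAt v ψ) := by
        refine Finset.sum_congr rfl fun v _ => ?_
        simp only [h']
        simp only [Fin.sum_univ_two, smul_add, add_smul, smul_smul, mul_comm]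
        abel
    _ = ∑ v, ∑ p, ∑ r, (∑ m, ∑ n, R m n k l * ∑ u, M r s n u * L p u m v) •
          (Y j r * X i p) (sliceAt v ψ) := by
        simp only [hLM]
    _ = _ := by
        simp only [Fin.sum_univ_two, Finset.smul_sum, Finset.sum_add_distrib, smul_add, add_smul,
          smul_smul]
        abel

/-- The monodromy operators of a chain with column parameters `ws` and row parameter `x`. -/
def monodromy (L : ℝ → ℝ → Wt d) : (n : ℕ) → (Fin n → ℝ) → ℝ → Fin 2 → Fin 2 → Module.End ℝ (Sp d n)
  | 0, _, _ => fun i k => if i = k then 1 else 0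
  | n + 1, ws, x => step (L x (ws 0)) (monodromy L n (Fin.tail ws) x)

lemma monodromy_succ (L : ℝ → ℝ → Wt d) (ws : Fin (n + 1) → ℝ) (x : ℝ) (i k : Fin 2) :
    monodromy L (n + 1) ws x i k = step (L x (ws 0)) (monodromy L n (Fin.tail ws) x) i k := rfl

lemma monodromy_zero (L : ℝ → ℝ → Wt d) (ws : Fin 0 → ℝ) (x : ℝ) (i k : Fin 2) :
    monodromy L 0 ws x i k = if i = k then 1 else 0 := rfl

/-- The state with all sites equal to `b`. -/
def vac (b : Fin d) (n : ℕ) : Sp d n := Pi.single (fun _ => b) 1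

/-- The coefficient of the state with all sites equal to `b`. -/
def cov (b : Fin d) (n : ℕ) : Sp d n →ₗ[ℝ] ℝ := LinearMap.proj fun _ => b

lemma sliceAt_vac (b s : Fin d) : sliceAt s (vac b (n + 1)) = if s = b then vac b n else 0 := by
  funext σ
  have : (fun _ => b : Fin (n + 1) → Fin d) = Fin.cons b fun _ => b := by
    funext j; refine Fin.cases ?_ (fun _ => ?_) j <;> simp
  by_cases h : s = b
  · subst h
    by_cases h2 : σ = fun _ => s
    · simp [sliceAt_apply, vac, this, h2]
    · simp [sliceAt_apply, vac, this, h2]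
  · simp [sliceAt_apply, vac, this, h]

lemma cov_succ (b : Fin d) (ψ : Sp d (n + 1)) : cov b (n + 1) ψ = cov b n (sliceAt b ψ) := by
  have : (fun _ => b : Fin (n + 1) → Fin d) = Fin.cons b fun _ => b := by
    funext j; refine Fin.cases ?_ (fun _ => ?_) j <;> simp
  simp [cov, sliceAt_apply, this]

end Step

/-! ### The two families of local weights -/

/-- Anisotropy parameters of the vertex models: `q > 1`, its inverse `p`, and `y = √(q + p)`. -/
structure Anis where
  q : ℝ
  p : ℝ
  y : ℝ
  one_lt : 1 < q
  q_mul_p : q * p = 1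
  y_pos : 0 < y
  y_sq : y ^ 2 = q + p

namespace Anis

variable (Δ : Anis)

/-- The basic bracket `q - q⁻¹`. -/
def c : ℝ := Δ.q - Δ.p

/-- Weights of the spin-one chain, with row parameter `x` and column parameter `w`. -/
def L3 (x w : ℝ) : Wt 3 := fun i s k t =>
  (![![![![Δ.q * x ^ 2 - Δ.p * w ^ 2, 0, 0], ![0, x ^ 2 - w ^ 2, 0],
        ![0, 0, Δ.p * x ^ 2 - Δ.q * w ^ 2]],
      ![![0, 0, 0], ![Δ.c * Δ.y * x * w, 0, 0], ![0, Δ.c * Δ.y * x * w, 0]]],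
    ![![![0, Δ.c * Δ.y * x * w, 0], ![0, 0, Δ.c * Δ.y * x * w], ![0, 0, 0]],
      ![![Δ.p * x ^ 2 - Δ.q * w ^ 2, 0, 0], ![0, x ^ 2 - w ^ 2, 0],
        ![0, 0, Δ.q * x ^ 2 - Δ.p * w ^ 2]]]] : Fin 2 → Fin 2 → Fin 3 → Fin 3 → ℝ) i k s t

/-- Weights of the six-vertex model, with row parameter `x` and column parameter `w`. -/
def L2 (x w : ℝ) : Wt 2 := fun i s k t =>
  (![![![![Δ.q * x ^ 2 - Δ.p * w ^ 2, 0], ![0, Δ.q * w ^ 2 - Δ.p * x ^ 2]],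
      ![![0, 0], ![Δ.c * (Δ.q + Δ.p) * x * w, 0]]],
    ![![![0, Δ.c * (Δ.q + Δ.p) * x * w], ![0, 0]],
      ![![Δ.q * w ^ 2 - Δ.p * x ^ 2, 0], ![0, Δ.q * x ^ 2 - Δ.p * w ^ 2]]]] :
    Fin 2 → Fin 2 → Fin 2 → Fin 2 → ℝ) i k s t

/-- The exchange matrix of two spin-one rows. -/
def R (x z : ℝ) : Fin 2 → Fin 2 → Fin 2 → Fin 2 → ℝ := fun i j k l =>
  (![![![![Δ.q * x ^ 2 - Δ.p * z ^ 2, 0], ![0, 0]],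
      ![![0, x ^ 2 - z ^ 2], ![Δ.c * x * z, 0]]],
    ![![![0, Δ.c * x * z], ![x ^ 2 - z ^ 2, 0]],
      ![![0, 0], ![0, Δ.q * x ^ 2 - Δ.p * z ^ 2]]]] :
    Fin 2 → Fin 2 → Fin 2 → Fin 2 → ℝ) i j k l

set_option maxHeartbeats 4000000 in
lemma L3_exchange (x z w : ℝ) : ∀ i j k l s v,
    ∑ m, ∑ n, Δ.R x z i j m n * ∑ u, Δ.L3 x w m s k u * Δ.L3 z w n u l v =
      ∑ m, ∑ n, Δ.R x z m n k l * ∑ u, Δ.L3 z w j s n u * Δ.L3 x w i u m v := by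
  have h1 := Δ.q_mul_p
  have h2 := Δ.y_sq
  intro i j k l s v
  simp only [Fin.sum_univ_two, Fin.sum_univ_three, L3, R, c]
  generalize Δ.q = q at *
  generalize Δ.p = p at *
  generalize Δ.y = y at *
  fin_cases i <;> fin_cases j <;> fin_cases k <;> fin_cases l <;> fin_cases s <;> fin_cases v <;>
    simp <;> grind

end Anis

/-! ### Exchange relations -/

section Exchange

variable {d n : ℕ}

/-- The diagonal monodromy entry preserving the first auxiliary state. -/
abbrev mA (L : ℝ → ℝ → Wt d) (ws : Fin n → ℝ) (x : ℝ) : Module.End ℝ (Sp d n) :=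
  monodromy L n ws x 0 0

/-- The row operator with domain wall auxiliary boundary conditions. -/
abbrev mB (L : ℝ → ℝ → Wt d) (ws : Fin n → ℝ) (x : ℝ) : Module.End ℝ (Sp d n) :=
  monodromy L n ws x 0 1

/-- The row operator with reversed domain wall auxiliary boundary conditions. -/
abbrev mC (L : ℝ → ℝ → Wt d) (ws : Fin n → ℝ) (x : ℝ) : Module.End ℝ (Sp d n) :=
  monodromy L n ws x 1 0

/-- The diagonal monodromy entry preserving the second auxiliary state. -/
abbrev mD (L : ℝ → ℝ → Wt d) (ws : Fin n → ℝ) (x : ℝ) : Module.End ℝ (Sp d n) :=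
  monodromy L n ws x 1 1

end Exchange

namespace Anis

variable (Δ : Anis)

lemma q_pos : 0 < Δ.q := one_pos.trans Δ.one_lt

lemma p_pos : 0 < Δ.p := pos_of_mul_pos_right (Δ.q_mul_p ▸ one_pos) Δ.q_pos.le

lemma p_lt_one : Δ.p < 1 := by
  nlinarith [Δ.one_lt, Δ.q_mul_p, Δ.p_pos]

lemma c_pos : 0 < Δ.c := sub_pos.2 (Δ.p_lt_one.trans Δ.one_lt)

lemma rtt {n : ℕ} (ws : Fin n → ℝ) (x z : ℝ) :
    RTT (Δ.R x z) (monodromy Δ.L3 n ws x) (monodromy Δ.L3 n ws z) := by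
  induction n with
  | zero =>
    intro i j k l
    simp only [monodromy_zero, Fin.sum_univ_two]
    fin_cases i <;> fin_cases j <;> fin_cases k <;> fin_cases l <;> simp [R]
  | succ n ih => exact (ih _).step (Δ.L3_exchange x z (ws 0))

variable {n : ℕ} (ws : Fin n → ℝ)

lemma mB_comm {x z : ℝ} (h : x ≠ 0 ∨ z ≠ 0) :
    Commute (mB Δ.L3 ws x) (mB Δ.L3 ws z) := by
  have key : ∀ x z : ℝ, Δ.q * x ^ 2 - Δ.p * z ^ 2 ≠ 0 → Commute (mB Δ.L3 ws x) (mB Δ.L3 ws z) := by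
    intro x z hxz
    have h1 := Δ.rtt ws x z 0 0 1 1
    simp [R, Fin.sum_univ_two] at h1
    exact smul_right_injective _ hxz h1
  by_cases h1 : Δ.q * x ^ 2 - Δ.p * z ^ 2 = 0
  · refine (key z x fun h2 => ?_).symm
    have hpq : Δ.p < Δ.q := Δ.p_lt_one.trans Δ.one_lt
    have hp := Δ.p_pos
    have h3 : (Δ.q - Δ.p) * (x ^ 2 + z ^ 2) = 0 := by linarith
    rcases mul_eq_zero.1 h3 with h4 | h4
    · linarith
    · have hx : x = 0 := by nlinarith [sq_nonneg x, sq_nonneg z]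
      have hz : z = 0 := by nlinarith [sq_nonneg x, sq_nonneg z]
      tauto
  · exact key x z h1

lemma mA_mul_mB (x z : ℝ) :
    (x ^ 2 - z ^ 2) • (mA Δ.L3 ws x * mB Δ.L3 ws z) =
      (Δ.p * x ^ 2 - Δ.q * z ^ 2) • (mB Δ.L3 ws z * mA Δ.L3 ws x) +
        (Δ.c * x * z) • (mB Δ.L3 ws x * mA Δ.L3 ws z) := by
  have h1 := Δ.rtt ws z x 0 0 1 0
  simp [R, Fin.sum_univ_two] at h1
  have h2 : Δ.c * x * z = Δ.c * z * x := by ring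
  rw [h2, ← sub_eq_zero]
  rw [← sub_eq_zero] at h1
  rw [← h1]
  module

lemma mD_mul_mB (x z : ℝ) :
    (x ^ 2 - z ^ 2) • (mD Δ.L3 ws x * mB Δ.L3 ws z) =
      (Δ.q * x ^ 2 - Δ.p * z ^ 2) • (mB Δ.L3 ws z * mD Δ.L3 ws x) -
        (Δ.c * x * z) • (mB Δ.L3 ws x * mD Δ.L3 ws z) := by
  have h1 := Δ.rtt ws x z 1 0 1 1
  simp [R, Fin.sum_univ_two] at h1
  rw [← sub_eq_zero]
  rw [← sub_eq_zero] at h1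
  rw [← h1]
  module

end Anis

/-! ### Algebraic Bethe ansatz -/

section Bethe

variable {V : Type*} [AddCommGroup V] [Module ℝ V]

lemma bethe_expansion {A B : ℝ → Module.End ℝ V} {f g : ℝ → ℝ → ℝ} {a : ℝ → ℝ} {v : V}
    (hAB : ∀ x z, 0 < x → 0 < z → x ≠ z →
      A x * B z = f x z • (B z * A x) + g x z • (B x * A z))
    (hBB : ∀ x z, 0 < x → 0 < z → Commute (B x) (B z))
    (hfg : ∀ x w i, x ≠ w → x ≠ i → w ≠ i → 0 < x → 0 < w → 0 < i →
      f x w * g x i + g x w * g w i = g x i * f i w)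
    (hA : ∀ x, A x v = a x • v) (l : List ℝ) (hl : ∀ i ∈ l, 0 < i) (hnd : l.Nodup)
    (x : ℝ) (hx : 0 < x) (hxl : x ∉ l) :
    A x ((l.map B).prod v) = (a x * (l.map (f x)).prod) • (l.map B).prod v +
      (l.map fun i => (g x i * (a i * ((l.erase i).map (f i)).prod)) •
        B x (((l.erase i).map B).prod v)).sum := by
  induction l generalizing x with
  | nil => simp [hA]
  | cons w l ih =>
    rw [List.nodup_cons] at hnd
    have hw : 0 < w := hl w (by simp)
    have hl' : ∀ i ∈ l, 0 < i := fun i hi => hl i (by simp [hi])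
    have hxw : x ≠ w := fun h => hxl (by simp [h])
    have hxl' : x ∉ l := fun h => hxl (by simp [h])
    have e1 : A x ((List.map B (w :: l)).prod v) =
        f x w • B w (A x ((l.map B).prod v)) + g x w • B x (A w ((l.map B).prod v)) := by
      simpa using congrArg (fun T : Module.End ℝ V => T ((l.map B).prod v)) (hAB x w hx hw hxw)
    rw [e1, ih hl' hnd.2 x hx hxl', ih hl' hnd.2 w hw hnd.1]
    simp only [map_add, map_smul, map_list_sum, List.map_map, List.smul_sum, List.map_cons,
      List.prod_cons, List.sum_cons, List.erase_cons_head, smul_add]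
    have e2 : (l.map fun i => (g x i * (a i * (((w :: l).erase i).map (f i)).prod)) •
        B x ((((w :: l).erase i).map B).prod v)).sum =
      (l.map fun i => (f x w * (g x i * (a i * ((l.erase i).map (f i)).prod))) •
          B w (B x (((l.erase i).map B).prod v))).sum +
      (l.map fun i => (g x w * (g w i * (a i * ((l.erase i).map (f i)).prod))) •
          B x (B w (((l.erase i).map B).prod v))).sum := by
      rw [← List.sum_map_add]
      refine congrArg List.sum (List.map_congr_left fun i hi => ?_)
      have hwi : w ≠ i := fun h => hnd.1 (h ▸ hi)
      have hxi : x ≠ i := fun h => hxl' (h ▸ hi)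
      have hc : B w (B x (((l.erase i).map B).prod v)) = B x (B w (((l.erase i).map B).prod v)) :=
        congrArg (fun T : Module.End ℝ V => T (((l.erase i).map B).prod v)) (hBB w x hw hx).eq
      rw [hc, ← add_smul, List.erase_cons_tail (by simpa using hwi)]
      simp only [List.map_cons, List.prod_cons, Module.End.mul_apply]
      congr 1
      linear_combination (-(a i * ((l.erase i).map (f i)).prod)) *
        hfg x w i hxw hxi hwi hx hw (hl' i hi)
    rw [e2]
    simp only [Function.comp_def, map_smul, smul_smul, Module.End.mul_apply]
    have e3 : f x w * (a x * (List.map (f x) l).prod) = a x * (f x w * (List.map (f x) l).prod) := by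
      ring
    rw [e3]
    abel

end Bethe

namespace Anis

variable (Δ : Anis) {n : ℕ}

lemma ofFn_eq_cons_tail {α : Type*} (ws : Fin (n + 1) → α) :
    List.ofFn ws = ws 0 :: List.ofFn (Fin.tail ws) := by
  rw [List.ofFn_succ]
  rfl

lemma mC_vac (ws : Fin n → ℝ) (x : ℝ) : mC Δ.L3 ws x (vac 0 n) = 0 := by
  induction n with
  | zero => simp [mC, monodromy_zero]
  | succ n ih =>
    refine sliceAt_ext fun s => ?_
    rw [mC, monodromy_succ, sliceAt_step]
    have := ih (Fin.tail ws)
    fin_cases s <;> simp [Fin.sum_univ_two, Fin.sum_univ_three, sliceAt_vac, L3, this]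

lemma mA_vac (ws : Fin n → ℝ) (x : ℝ) : mA Δ.L3 ws x (vac 0 n) =
    ((List.ofFn ws).map fun w => Δ.q * x ^ 2 - Δ.p * w ^ 2).prod • vac 0 n := by
  induction n with
  | zero => simp [mA, monodromy_zero]
  | succ n ih =>
    refine sliceAt_ext fun s => ?_
    rw [mA, monodromy_succ, sliceAt_step, ofFn_eq_cons_tail]
    have := ih (Fin.tail ws)
    fin_cases s <;>
      simp [Fin.sum_univ_two, Fin.sum_univ_three, sliceAt_vac, L3, this, smul_smul]

lemma mD_vac (ws : Fin n → ℝ) (x : ℝ) : mD Δ.L3 ws x (vac 0 n) =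
    ((List.ofFn ws).map fun w => Δ.p * x ^ 2 - Δ.q * w ^ 2).prod • vac 0 n := by
  induction n with
  | zero => simp [mD, monodromy_zero]
  | succ n ih =>
    refine sliceAt_ext fun s => ?_
    rw [mD, monodromy_succ, sliceAt_step, ofFn_eq_cons_tail]
    have := ih (Fin.tail ws)
    have h2 := Δ.mC_vac (Fin.tail ws) x
    fin_cases s <;>
      simp [Fin.sum_univ_two, Fin.sum_univ_three, sliceAt_vac, L3, this, h2, smul_smul]

/-- The supersymmetry singlet of the inhomogeneous chain. -/
def singlet (ws : Fin n → ℝ) : Sp 3 n := ((List.ofFn ws).map (mB Δ.L3 ws)).prod (vac 0 n)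

lemma sq_sub_sq_ne {x z : ℝ} (hx : 0 < x) (hz : 0 < z) (h : x ≠ z) : x ^ 2 - z ^ 2 ≠ 0 := by
  rw [sub_ne_zero]
  exact fun h2 => h (by rwa [sq_eq_sq₀ hx.le hz.le] at h2)

lemma mA_singlet {ws : Fin n → ℝ} (hpos : ∀ i, 0 < ws i) (hinj : Function.Injective ws)
    {x : ℝ} (hx : 0 < x) (hxw : ∀ i, x ≠ ws i) :
    mA Δ.L3 ws x (Δ.singlet ws) = mD Δ.L3 ws x (Δ.singlet ws) := by
  have hl : ∀ i ∈ List.ofFn ws, 0 < i := by simpa [List.mem_ofFn] using hpos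
  have hnd : (List.ofFn ws).Nodup := List.nodup_ofFn.2 hinj
  have hxl : x ∉ List.ofFn ws := by simpa [List.mem_ofFn, eq_comm] using hxw
  have hBB : ∀ x z, 0 < x → 0 < z → Commute (mB Δ.L3 ws x) (mB Δ.L3 ws z) :=
    fun x z hx _ => Δ.mB_comm ws (Or.inl hx.ne')
  have eA := bethe_expansion (A := mA Δ.L3 ws) (B := mB Δ.L3 ws)
    (f := fun x z => (Δ.p * x ^ 2 - Δ.q * z ^ 2) / (x ^ 2 - z ^ 2))
    (g := fun x z => Δ.c * x * z / (x ^ 2 - z ^ 2))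
    (fun x z hx hz hxz => by
      have h := sq_sub_sq_ne hx hz hxz
      have := Δ.mA_mul_mB ws x z
      rw [div_eq_inv_mul, div_eq_inv_mul, mul_smul, mul_smul, ← smul_add, ← this, smul_smul,
        inv_mul_cancel₀ h, one_smul])
    hBB
    (fun x w i hxw hxi hwi hx hw hi => by
      have h1 := sq_sub_sq_ne hx hw hxw
      have h2 := sq_sub_sq_ne hx hi hxi
      have h3 := sq_sub_sq_ne hw hi hwi
      have h4 := sq_sub_sq_ne hi hw hwi.symm
      rw [c]
      field_simp
      ring) (Δ.mA_vac ws) _ hl hnd x hx hxl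
  have eD := bethe_expansion (A := mD Δ.L3 ws) (B := mB Δ.L3 ws)
    (f := fun x z => (Δ.q * x ^ 2 - Δ.p * z ^ 2) / (x ^ 2 - z ^ 2))
    (g := fun x z => -(Δ.c * x * z) / (x ^ 2 - z ^ 2))
    (fun x z hx hz hxz => by
      have h := sq_sub_sq_ne hx hz hxz
      have := Δ.mD_mul_mB ws x z
      rw [div_eq_inv_mul, div_eq_inv_mul, mul_smul, mul_smul, ← smul_add, neg_smul,
        ← sub_eq_add_neg, ← this, smul_smul, inv_mul_cancel₀ h, one_smul])
    hBB
    (fun x w i hxw hxi hwi hx hw hi => by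
      have h1 := sq_sub_sq_ne hx hw hxw
      have h2 := sq_sub_sq_ne hx hi hxi
      have h3 := sq_sub_sq_ne hw hi hwi
      have h4 := sq_sub_sq_ne hi hw hwi.symm
      rw [c]
      field_simp
      ring) (Δ.mD_vac ws) _ hl hnd x hx hxl
  rw [singlet, eA, eD]
  congr 1
  · congr 1
    rw [← List.prod_map_mul, ← List.prod_map_mul]
    refine congrArg List.prod (List.map_congr_left fun w _ => ?_)
    ring
  · refine congrArg List.sum (List.map_congr_left fun i hi => ?_)
    congr 1
    rw [← List.prod_map_erase _ hi, ← List.prod_map_erase (fun w => Δ.p * i ^ 2 - Δ.q * w ^ 2) hi]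
    have : ((List.ofFn ws).erase i |>.map fun w => Δ.q * i ^ 2 - Δ.p * w ^ 2).prod *
        ((List.ofFn ws).erase i |>.map fun z =>
          (Δ.p * i ^ 2 - Δ.q * z ^ 2) / (i ^ 2 - z ^ 2)).prod =
      ((List.ofFn ws).erase i |>.map fun w => Δ.p * i ^ 2 - Δ.q * w ^ 2).prod *
        ((List.ofFn ws).erase i |>.map fun z =>
          (Δ.q * i ^ 2 - Δ.p * z ^ 2) / (i ^ 2 - z ^ 2)).prod := by
      rw [← List.prod_map_mul, ← List.prod_map_mul]
      refine congrArg List.prod (List.map_congr_left fun w _ => ?_)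
      ring
    linear_combination Δ.c * x * i / (x ^ 2 - i ^ 2) * (Δ.q * i ^ 2 - Δ.p * i ^ 2) * this

end Anis

/-! ### Spin reversal -/

namespace Anis

variable (Δ : Anis) {n : ℕ}

section Slices

variable (ws : Fin (n + 1) → ℝ) (x : ℝ) (ψ : Sp 3 (n + 1))

lemma sliceAt_zero_mA : sliceAt 0 (mA Δ.L3 ws x ψ) =
    (Δ.q * x ^ 2 - Δ.p * ws 0 ^ 2) • mA Δ.L3 (Fin.tail ws) x (sliceAt 0 ψ) +
      (Δ.c * Δ.y * x * ws 0) • mB Δ.L3 (Fin.tail ws) x (sliceAt 1 ψ) := by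
  simp [monodromy_succ, Fin.sum_univ_two, Fin.sum_univ_three, L3]

lemma sliceAt_one_mA : sliceAt 1 (mA Δ.L3 ws x ψ) =
    (x ^ 2 - ws 0 ^ 2) • mA Δ.L3 (Fin.tail ws) x (sliceAt 1 ψ) +
      (Δ.c * Δ.y * x * ws 0) • mB Δ.L3 (Fin.tail ws) x (sliceAt 2 ψ) := by
  simp [monodromy_succ, Fin.sum_univ_two, Fin.sum_univ_three, L3]

lemma sliceAt_two_mA : sliceAt 2 (mA Δ.L3 ws x ψ) =
    (Δ.p * x ^ 2 - Δ.q * ws 0 ^ 2) • mA Δ.L3 (Fin.tail ws) x (sliceAt 2 ψ) := by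
  simp [monodromy_succ, Fin.sum_univ_two, Fin.sum_univ_three, L3]

lemma sliceAt_zero_mD : sliceAt 0 (mD Δ.L3 ws x ψ) =
    (Δ.p * x ^ 2 - Δ.q * ws 0 ^ 2) • mD Δ.L3 (Fin.tail ws) x (sliceAt 0 ψ) := by
  simp [monodromy_succ, Fin.sum_univ_two, Fin.sum_univ_three, L3]

lemma sliceAt_zero_mB : sliceAt 0 (mB Δ.L3 ws x ψ) =
    (Δ.p * x ^ 2 - Δ.q * ws 0 ^ 2) • mB Δ.L3 (Fin.tail ws) x (sliceAt 0 ψ) := by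
  simp [monodromy_succ, Fin.sum_univ_two, Fin.sum_univ_three, L3]

lemma sliceAt_one_mB : sliceAt 1 (mB Δ.L3 ws x ψ) =
    (Δ.c * Δ.y * x * ws 0) • mA Δ.L3 (Fin.tail ws) x (sliceAt 0 ψ) +
    (x ^ 2 - ws 0 ^ 2) • mB Δ.L3 (Fin.tail ws) x (sliceAt 1 ψ) := by
  simp [monodromy_succ, Fin.sum_univ_two, Fin.sum_univ_three, L3]

lemma sliceAt_two_mB : sliceAt 2 (mB Δ.L3 ws x ψ) =
    (Δ.c * Δ.y * x * ws 0) • mA Δ.L3 (Fin.tail ws) x (sliceAt 1 ψ) +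
    (Δ.q * x ^ 2 - Δ.p * ws 0 ^ 2) • mB Δ.L3 (Fin.tail ws) x (sliceAt 2 ψ) := by
  simp [monodromy_succ, Fin.sum_univ_two, Fin.sum_univ_three, L3]

lemma sliceAt_zero_prod_mB (l : List ℝ) : sliceAt 0 ((l.map (mB Δ.L3 ws)).prod ψ) =
    (l.map fun x => Δ.p * x ^ 2 - Δ.q * ws 0 ^ 2).prod •
      (l.map (mB Δ.L3 (Fin.tail ws))).prod (sliceAt 0 ψ) := by
  induction l with
  | nil => simp
  | cons x l ih =>
    simp only [List.map_cons, List.prod_cons, Module.End.mul_apply, sliceAt_zero_mB, ih, map_smul,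
      smul_smul]

end Slices

lemma mA_injective {ws : Fin n → ℝ} {x : ℝ} (h1 : ∀ i, Δ.q * x ^ 2 - Δ.p * ws i ^ 2 ≠ 0)
    (h2 : ∀ i, x ^ 2 - ws i ^ 2 ≠ 0) (h3 : ∀ i, Δ.p * x ^ 2 - Δ.q * ws i ^ 2 ≠ 0)
    {ψ : Sp 3 n} (h : mA Δ.L3 ws x ψ = 0) : ψ = 0 := by
  induction n with
  | zero => simpa [monodromy_zero] using h
  | succ n ih =>
    have ih' := @ih (Fin.tail ws) (fun i => h1 _) (fun i => h2 _) (fun i => h3 _)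
    have e2 := Δ.sliceAt_two_mA ws x ψ
    rw [h, map_zero, eq_comm, smul_eq_zero_iff_right (h3 0)] at e2
    have e2 := ih' e2
    have e1 := Δ.sliceAt_one_mA ws x ψ
    rw [h, map_zero, e2, map_zero, smul_zero, add_zero, eq_comm,
      smul_eq_zero_iff_right (h2 0)] at e1
    have e1 := ih' e1
    have e0 := Δ.sliceAt_zero_mA ws x ψ
    rw [h, map_zero, e1, map_zero, smul_zero, add_zero, eq_comm,
      smul_eq_zero_iff_right (h1 0)] at e0
    have e0 := ih' e0
    refine sliceAt_ext fun s => ?_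
    fin_cases s <;> simpa

/-- Spin reversal at every site. -/
def spinFlip (n : ℕ) : Sp 3 n →ₗ[ℝ] Sp 3 n :=
  LinearMap.funLeft ℝ ℝ fun σ j => Fin.rev (σ j)

lemma spinFlip_spinFlip (ψ : Sp 3 n) : spinFlip n (spinFlip n ψ) = ψ := by
  funext σ
  simp [spinFlip, LinearMap.funLeft_apply]

lemma sliceAt_spinFlip (s : Fin 3) (ψ : Sp 3 (n + 1)) :
    sliceAt s (spinFlip (n + 1) ψ) = spinFlip n (sliceAt (Fin.rev s) ψ) := by
  funext σ
  have : (fun j => Fin.rev ((Fin.cons s σ : Fin (n + 1) → Fin 3) j)) =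
      Fin.cons (Fin.rev s) fun j => Fin.rev (σ j) := by
    funext j
    refine Fin.cases ?_ (fun _ => ?_) j <;> simp
  simp [sliceAt_apply, spinFlip, LinearMap.funLeft_apply, this]

lemma spinFlip_monodromy (ws : Fin n → ℝ) (x : ℝ) (i k : Fin 2) (ψ : Sp 3 n) :
    spinFlip n (monodromy Δ.L3 n ws x i k ψ) =
      monodromy Δ.L3 n ws x (Fin.rev i) (Fin.rev k) (spinFlip n ψ) := by
  induction n generalizing i k with
  | zero => fin_cases i <;> fin_cases k <;> simp [monodromy_zero]
  | succ n ih =>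
    refine sliceAt_ext fun s => ?_
    have e : Fin.rev (1 : Fin 3) = 1 := rfl
    have e2 : Fin.rev (2 : Fin 3) = 0 := rfl
    have e3 : Fin.rev (0 : Fin 3) = 2 := rfl
    have e4 : Fin.rev (0 : Fin 2) = 1 := rfl
    have e5 : Fin.rev (1 : Fin 2) = 0 := rfl
    rw [sliceAt_spinFlip, monodromy_succ, monodromy_succ, sliceAt_step, sliceAt_step]
    simp only [map_add, map_smul, ih, Fin.sum_univ_two, Fin.sum_univ_three, sliceAt_spinFlip,
      e, e2, e3, e4, e5]
    fin_cases k <;> fin_cases s <;> simp [L3] <;> abel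

/-- Column parameters in general position. -/
structure Generic (ws : Fin n → ℝ) : Prop where
  one_le : ∀ i, 1 ≤ ws i
  lt_q : ∀ i, ws i < Δ.q
  inj : Function.Injective ws

variable {Δ}

lemma Generic.pos {ws : Fin n → ℝ} (h : Δ.Generic ws) (i : Fin n) : 0 < ws i :=
  one_pos.trans_le (h.one_le i)

lemma Generic.tail {ws : Fin (n + 1) → ℝ} (h : Δ.Generic ws) : Δ.Generic (Fin.tail ws) :=
  ⟨fun _ => h.one_le _, fun _ => h.lt_q _, fun _ _ e => Fin.succ_injective _ (h.inj e)⟩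

lemma Generic.zero_ne_tail {ws : Fin (n + 1) → ℝ} (h : Δ.Generic ws) (i : Fin n) :
    ws 0 ≠ Fin.tail ws i := fun e => (Fin.succ_ne_zero i).symm (h.inj e)

variable (Δ)

lemma spinFlip_singlet {ws : Fin n → ℝ} (hg : Δ.Generic ws) :
    spinFlip n (Δ.singlet ws) = Δ.singlet ws := by
  induction n with
  | zero =>
    funext σ
    simp [spinFlip, LinearMap.funLeft_apply, Subsingleton.elim (fun j => Fin.rev (σ j)) σ]
  | succ n ih =>
    have hw := hg.pos 0
    have hq := Δ.one_lt
    have hqp := Δ.q_mul_p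
    have hp := Δ.p_pos
    have hx : 0 < Δ.q * ws 0 := mul_pos Δ.q_pos hw
    have hxw : ∀ i, Δ.q * ws 0 ≠ ws i := fun i => by
      have h1 := hg.one_le 0
      have h2 := hg.lt_q i
      nlinarith
    set Φ := Δ.singlet ws with hΦ
    have hAD : mA Δ.L3 ws (Δ.q * ws 0) Φ = mD Δ.L3 ws (Δ.q * ws 0) Φ :=
      Δ.mA_singlet hg.pos hg.inj hx hxw
    have h1 : sliceAt 1 (spinFlip (n + 1) Φ) = sliceAt 1 Φ := by
      have hs : sliceAt 1 Φ = (Δ.c * Δ.y * ws 0 * ws 0) • mA Δ.L3 (Fin.tail ws) (ws 0)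
          (((List.ofFn (Fin.tail ws)).map fun x => Δ.p * x ^ 2 - Δ.q * ws 0 ^ 2).prod •
            Δ.singlet (Fin.tail ws)) := by
        rw [hΦ, singlet, ofFn_eq_cons_tail ws]
        simp only [List.map_cons, List.prod_cons, Module.End.mul_apply, sliceAt_one_mB,
          sliceAt_zero_prod_mB, sliceAt_vac, if_true, sub_self, zero_smul, add_zero]
        rfl
      have hs' := Δ.mA_singlet hg.tail.pos hg.tail.inj hw hg.zero_ne_tail
      rw [sliceAt_spinFlip, show Fin.rev (1 : Fin 3) = 1 from rfl, hs]
      simp only [map_smul, spinFlip_monodromy, ih hg.tail]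
      rw [hs']
      rfl
    have h2 : mA Δ.L3 ws (Δ.q * ws 0) (Φ - spinFlip (n + 1) Φ) =
        mD Δ.L3 ws (Δ.q * ws 0) (Φ - spinFlip (n + 1) Φ) := by
      have e1 := Δ.spinFlip_monodromy ws (Δ.q * ws 0) 1 1 Φ
      have e2 := Δ.spinFlip_monodromy ws (Δ.q * ws 0) 0 0 Φ
      rw [map_sub, map_sub, hAD]
      congr 1
      exact e1.symm.trans ((congrArg _ hAD.symm).trans e2)
    have h3 : sliceAt 0 (Φ - spinFlip (n + 1) Φ) = 0 := by
      have e := congrArg (sliceAt 0) h2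
      rw [sliceAt_zero_mA, sliceAt_zero_mD, map_sub (sliceAt 1), h1, sub_self, map_zero, smul_zero,
        add_zero, show Δ.p * (Δ.q * ws 0) ^ 2 - Δ.q * ws 0 ^ 2 = 0 by
          linear_combination Δ.q * ws 0 ^ 2 * hqp, zero_smul, smul_eq_zero_iff_right] at e
      · have hlt : ∀ i, (ws 0) ^ 2 < Δ.q ^ 2 ∧ (Fin.tail ws i) ^ 2 < Δ.q ^ 2 := fun i =>
          ⟨pow_lt_pow_left₀ (hg.lt_q 0) hw.le two_ne_zero,
            pow_lt_pow_left₀ (hg.tail.lt_q i) (hg.tail.pos i).le two_ne_zero⟩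
        have hge : 1 ≤ ws 0 ^ 2 := one_le_pow₀ (hg.one_le 0)
        refine Δ.mA_injective (fun i => ?_) (fun i => ?_) (fun i => ?_) e
        · have := hlt i
          have h5 : Δ.p * (Fin.tail ws i) ^ 2 < Δ.q ^ 2 := by nlinarith [Δ.p_lt_one]
          have h6 : Δ.q ^ 2 ≤ Δ.q * (Δ.q * ws 0) ^ 2 := by
            have : Δ.q ^ 2 * 1 ≤ Δ.q ^ 2 * (Δ.q * ws 0 ^ 2) :=
              mul_le_mul_of_nonneg_left (by nlinarith) (by positivity)
            nlinarith
          linarith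
        · exact sq_sub_sq_ne hx (hg.tail.pos i) (hxw _)
        · have h7 := sq_sub_sq_ne hw (hg.tail.pos i) (hg.zero_ne_tail i)
          intro h8
          apply h7
          have h9 : Δ.q * (ws 0 ^ 2 - Fin.tail ws i ^ 2) = 0 := by
            linear_combination h8 - Δ.q * ws 0 ^ 2 * hqp
          exact (mul_eq_zero.1 h9).resolve_left Δ.q_pos.ne'
      · have h6 : Δ.q * (Δ.q * ws 0) ^ 2 = Δ.q ^ 3 * ws 0 ^ 2 := by ring
        have h7 : (1 : ℝ) < Δ.q ^ 3 := one_lt_pow₀ hq (by norm_num)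
        have h8 := Δ.p_lt_one
        have h9 : 0 < ws 0 ^ 2 := by positivity
        rw [h6, ← sub_mul]
        exact (mul_pos (by linarith) h9).ne'
    have h4 : sliceAt 2 (Φ - spinFlip (n + 1) Φ) = 0 := by
      rw [map_sub, sliceAt_spinFlip, sub_eq_zero] at h3
      rw [map_sub, sliceAt_spinFlip, sub_eq_zero, show Fin.rev (2 : Fin 3) = 0 from rfl, h3,
        spinFlip_spinFlip]
      rfl
    refine (sub_eq_zero.1 (sliceAt_ext fun s => ?_)).symm
    rw [map_zero]
    fin_cases s
    · exact h3
    · simp [h1]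
    · exact h4

end Anis

/-! ### Intertwiners exchanging columns -/

section Intertwine

variable {d n : ℕ}

/-- Two choices of column parameters are related by an operator intertwining the monodromies and
compatible with the extremal states `b` and `t`. -/
def Intertwined (L : ℝ → ℝ → Wt d) (b t : Fin d) (ws ws' : Fin n → ℝ) : Prop :=
  ∃ (I : Module.End ℝ (Sp d n)) (κ : ℝ), κ ≠ 0 ∧
    (∀ x i k ψ, I (monodromy L n ws x i k ψ) = monodromy L n ws' x i k (I ψ)) ∧
    I (vac b n) = κ • vac b n ∧ ∀ ψ, cov t n (I ψ) = κ * cov t n ψ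

variable {L : ℝ → ℝ → Wt d} {b t : Fin d}

lemma Intertwined.refl (ws : Fin n → ℝ) : Intertwined L b t ws ws :=
  ⟨1, 1, one_ne_zero, by simp, by simp, by simp⟩

lemma Intertwined.trans {ws ws' ws'' : Fin n → ℝ} (h : Intertwined L b t ws ws') (h' : Intertwined L b t ws' ws'') :
    Intertwined L b t ws ws'' := by
  obtain ⟨I, κ, hκ, h1, h2, h3⟩ := h
  obtain ⟨J, μ, hμ, g1, g2, g3⟩ := h'
  refine ⟨J * I, μ * κ, mul_ne_zero hμ hκ, ?_, ?_, ?_⟩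
  · intro x i k ψ
    simp [h1, g1]
  · simp [h2, g2, smul_smul, mul_comm]
  · intro ψ
    simp [h3, g3, mul_assoc]

lemma Intertwined.cons (w : ℝ) {ws ws' : Fin n → ℝ} (h : Intertwined L b t ws ws') :
    Intertwined L b t (Fin.cons w ws : Fin (n + 1) → ℝ) (Fin.cons w ws' : Fin (n + 1) → ℝ) := by
  obtain ⟨I, κ, hκ, h1, h2, h3⟩ := h
  refine ⟨⟨⟨fun ψ => glue fun s => I (sliceAt s ψ), fun ψ χ => sliceAt_ext fun s => by simp⟩,
    fun a ψ => sliceAt_ext fun s => by simp⟩, κ, hκ, ?_, ?_, ?_⟩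
  · intro x i k ψ
    refine sliceAt_ext fun s => ?_
    simp [monodromy_succ, h1]
  · refine sliceAt_ext fun s => ?_
    by_cases hs : s = b <;> simp [sliceAt_vac, hs, h2]
  · intro ψ
    simp [cov_succ, h3]

/-- The local exchange relation of two columns with given parameters. -/
def ColExchange (L : ℝ → ℝ → Wt d) (b t : Fin d) (a a' : ℝ) : Prop :=
  ∃ (I : Fin d → Fin d → Fin d → Fin d → ℝ) (κ : ℝ), κ ≠ 0 ∧
    (∀ x k r s₁ s₂ r₁ r₂, ∑ t₁, ∑ t₂, ∑ p, I s₁ s₂ t₁ t₂ * (L x a p t₁ k r₁ * L x a' r t₂ p r₂) =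
      ∑ t₁, ∑ t₂, ∑ p, L x a' p s₁ k t₁ * L x a r s₂ p t₂ * I t₁ t₂ r₁ r₂) ∧
    (∀ s₁ s₂, I s₁ s₂ b b = if s₁ = b ∧ s₂ = b then κ else 0) ∧
    (∀ r₁ r₂, I t t r₁ r₂ = if r₁ = t ∧ r₂ = t then κ else 0)

lemma ColExchange.inter {a a' : ℝ} (h : ColExchange L b t a a') (ws : Fin n → ℝ) :
    Intertwined L b t (Fin.cons a (Fin.cons a' ws : Fin (n + 1) → ℝ) : Fin (n + 2) → ℝ)
      (Fin.cons a' (Fin.cons a ws : Fin (n + 1) → ℝ) : Fin (n + 2) → ℝ) := by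
  obtain ⟨I, κ, hκ, h1, h2, h3⟩ := h
  refine ⟨⟨⟨fun ψ => glue fun s₁ => glue fun s₂ => ∑ t₁, ∑ t₂, I s₁ s₂ t₁ t₂ •
      sliceAt t₂ (sliceAt t₁ ψ), fun ψ χ => sliceAt_ext fun s => sliceAt_ext fun s' => by
        simp [Finset.sum_add_distrib]⟩,
    fun a ψ => sliceAt_ext fun s => sliceAt_ext fun s' => by
      simp [Finset.smul_sum, smul_smul, mul_comm]⟩, κ, hκ, ?_, ?_, ?_⟩
  · intro x i k ψ
    refine sliceAt_ext fun s₁ => sliceAt_ext fun s₂ => ?_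
    simp only [monodromy_succ, LinearMap.coe_mk, AddHom.coe_mk, sliceAt_glue, sliceAt_step,
      map_sum, map_smul, Fin.cons_zero, Fin.tail_cons, Finset.smul_sum, smul_smul]
    have key := fun r r₁ r₂ => h1 x k r s₁ s₂ r₁ r₂
    calc _ = ∑ r, ∑ r₁, ∑ r₂, (∑ t₁, ∑ t₂, ∑ p, I s₁ s₂ t₁ t₂ *
          (L x a p t₁ k r₁ * L x a' r t₂ p r₂)) •
            monodromy L n ws x i r (sliceAt r₂ (sliceAt r₁ ψ)) := by
          simp only [Finset.sum_smul]
          simp only [← Fintype.sum_prod_type']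
          exact Fintype.sum_equiv ⟨fun ⟨t₁, t₂, p, r₁, r, r₂⟩ => ⟨r, r₁, r₂, t₁, t₂, p⟩,
            fun ⟨r, r₁, r₂, t₁, t₂, p⟩ => ⟨t₁, t₂, p, r₁, r, r₂⟩, fun _ => rfl, fun _ => rfl⟩
            _ _ fun _ => rfl
      _ = _ := by
          simp only [key, Finset.sum_smul]
          simp only [← Fintype.sum_prod_type']
          refine Fintype.sum_equiv ⟨fun ⟨r, r₁, r₂, t₁, t₂, p⟩ => ⟨p, t₁, r, t₂, r₁, r₂⟩,
            fun ⟨p, t₁, r, t₂, r₁, r₂⟩ => ⟨r, r₁, r₂, t₁, t₂, p⟩, fun _ => rfl, fun _ => rfl⟩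
            _ _ fun _ => ?_
          simp only [mul_assoc, Equiv.coe_fn_mk]
  · refine sliceAt_ext fun s₁ => sliceAt_ext fun s₂ => ?_
    simp only [LinearMap.coe_mk, AddHom.coe_mk, sliceAt_glue, sliceAt_vac, map_smul]
    rw [Finset.sum_eq_single b, Finset.sum_eq_single b]
    · by_cases hs1 : s₁ = b <;> by_cases hs2 : s₂ = b <;> simp [sliceAt_vac, hs1, hs2, h2]
    all_goals simp +contextual [sliceAt_vac]
  · intro ψ
    simp only [LinearMap.coe_mk, AddHom.coe_mk, cov_succ, sliceAt_glue, h3, map_sum, map_smul]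
    rw [Finset.sum_eq_single t, Finset.sum_eq_single t]
    · simp
    all_goals simp +contextual

lemma cons_succAbove_succ (ws : Fin (n + 2) → ℝ) (j : Fin (n + 1)) :
    (fun i => ws (j.succ.succAbove i)) =
      (Fin.cons (ws 0) fun i => Fin.tail ws (j.succAbove i) : Fin (n + 1) → ℝ) := by
  funext i
  refine Fin.cases ?_ (fun i => ?_) i <;> simp [Fin.tail]

lemma ofFn_perm_cons_succAbove (ws : Fin (n + 1) → ℝ) (j : Fin (n + 1)) :
    (List.ofFn ws).Perm (ws j :: List.ofFn fun i => ws (j.succAbove i)) := by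
  induction n with
  | zero =>
    obtain rfl : j = 0 := Fin.fin_one_eq_zero j
    rw [Anis.ofFn_eq_cons_tail ws]
    rfl
  | succ n ih =>
    refine Fin.cases ?_ (fun j => ?_) j
    · rw [Anis.ofFn_eq_cons_tail ws]
      rfl
    · rw [cons_succAbove_succ, Anis.ofFn_eq_cons_tail ws, Anis.ofFn_eq_cons_tail (Fin.cons _ _),
        Fin.cons_zero, Fin.tail_cons]
      exact ((ih (Fin.tail ws) j).cons _).trans (List.Perm.swap _ _ _)

lemma Intertwined.bring_front {S : ℝ → Prop}
    (hS : ∀ a a', S a → S a' → ColExchange L b t a a') (ws : Fin (n + 1) → ℝ) (hws : ∀ i, S (ws i))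
    (j : Fin (n + 1)) :
    Intertwined L b t ws (Fin.cons (ws j) fun i => ws (j.succAbove i) : Fin (n + 1) → ℝ) := by
  have hzero : ∀ {n : ℕ} (ws : Fin (n + 1) → ℝ),
      Intertwined L b t ws (Fin.cons (ws 0) fun i => ws (Fin.succAbove 0 i) : Fin (n + 1) → ℝ) := by
    intro n ws
    have : (Fin.cons (ws 0) fun i => ws (Fin.succAbove 0 i) : Fin (n + 1) → ℝ) = ws :=
      Fin.cons_self_tail ws
    rw [this]
    exact Intertwined.refl _
  induction n with
  | zero =>
    obtain rfl : j = 0 := Fin.fin_one_eq_zero j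
    exact hzero ws
  | succ n ih =>
    refine Fin.cases (hzero ws) (fun j => ?_) j
    have h3 := (ih (Fin.tail ws) (fun i => hws _) j).cons (ws 0)
    rw [Fin.cons_self_tail] at h3
    rw [cons_succAbove_succ]
    exact h3.trans ((hS _ _ (hws 0) (hws j.succ)).inter _)

/-- The domain wall partition function with row parameters `xs` and column parameters `ws`. -/
def dwpf (L : ℝ → ℝ → Wt d) (b t : Fin d) (ws : Fin n → ℝ) (xs : List ℝ) : ℝ :=
  cov t n ((xs.map (mB L ws)).prod (vac b n))

lemma Intertwined.dwpf_eq {ws ws' : Fin n → ℝ} (h : Intertwined L b t ws ws') (xs : List ℝ) :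
    dwpf L b t ws xs = dwpf L b t ws' xs := by
  obtain ⟨I, κ, hκ, h1, h2, h3⟩ := h
  have key : ∀ ψ, I ((xs.map (mB L ws)).prod ψ) = (xs.map (mB L ws')).prod (I ψ) := by
    intro ψ
    induction xs with
    | nil => simp
    | cons x xs ih => simp [h1, ih]
  have := h3 ((xs.map (mB L ws)).prod (vac b n))
  rw [key, h2, map_smul, map_smul, smul_eq_mul] at this
  exact (mul_left_cancel₀ hκ this).symm

end Intertwine

namespace Anis

variable (Δ : Anis)

/-- The operator exchanging two spin-one columns. -/
def I3 (a b : ℝ) : Fin 3 → Fin 3 → Fin 3 → Fin 3 → ℝ := fun s₁ s₂ t₁ t₂ =>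
  let b₁ := Δ.q * a ^ 2 - Δ.p * b ^ 2
  let b₂ := Δ.q ^ 2 * a ^ 2 - Δ.p ^ 2 * b ^ 2
  let b₀ := a ^ 2 - b ^ 2
  let b₃ := Δ.p * a ^ 2 - Δ.q * b ^ 2
  let h₁ := (Δ.q - Δ.p) * a * b
  let h₂ := (Δ.q ^ 2 - Δ.p ^ 2) * a * b
  (![![![![b₁ * b₂, 0, 0], ![0, 0, 0], ![0, 0, 0]],
      ![![0, h₂ * b₁, 0], ![b₀ * b₁, 0, 0], ![0, 0, 0]],
      ![![0, 0, h₁ * h₂], ![0, h₂ * b₀, 0], ![b₀ * b₃, 0, 0]]],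
    ![![![0, b₀ * b₁, 0], ![h₂ * b₁, 0, 0], ![0, 0, 0]],
      ![![0, 0, h₂ * b₀], ![0, b₀ * b₁ + h₁ * h₂, 0], ![h₂ * b₀, 0, 0]],
      ![![0, 0, 0], ![0, 0, h₂ * b₁], ![0, b₀ * b₁, 0]]],
    ![![![0, 0, b₀ * b₃], ![0, h₂ * b₀, 0], ![h₁ * h₂, 0, 0]],
      ![![0, 0, 0], ![0, 0, b₀ * b₁], ![0, h₂ * b₁, 0]],
      ![![0, 0, 0], ![0, 0, 0], ![0, 0, b₁ * b₂]]]] : Fin 3 → Fin 3 → Fin 3 → Fin 3 → ℝ)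
    s₁ s₂ t₁ t₂

/-- The operator exchanging two six-vertex columns. -/
def I2 (a b : ℝ) : Fin 2 → Fin 2 → Fin 2 → Fin 2 → ℝ := fun s₁ s₂ t₁ t₂ =>
  let b₂ := Δ.q ^ 2 * a ^ 2 - Δ.p ^ 2 * b ^ 2
  let b₀ := a ^ 2 - b ^ 2
  let h₂ := (Δ.q ^ 2 - Δ.p ^ 2) * a * b
  (![![![![b₂, 0], ![0, 0]], ![![0, h₂], ![-b₀, 0]]],
    ![![![0, -b₀], ![h₂, 0]], ![![0, 0], ![0, b₂]]]] : Fin 2 → Fin 2 → Fin 2 → Fin 2 → ℝ)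
    s₁ s₂ t₁ t₂

lemma L3_values (x w : ℝ) :
    Δ.L3 x w 0 0 0 0 = Δ.q * x ^ 2 - Δ.p * w ^ 2 ∧
    Δ.L3 x w 0 0 0 1 = 0 ∧
    Δ.L3 x w 0 0 0 2 = 0 ∧
    Δ.L3 x w 0 0 1 0 = 0 ∧
    Δ.L3 x w 0 0 1 1 = 0 ∧
    Δ.L3 x w 0 0 1 2 = 0 ∧
    Δ.L3 x w 0 1 0 0 = 0 ∧
    Δ.L3 x w 0 1 0 1 = x ^ 2 - w ^ 2 ∧
    Δ.L3 x w 0 1 0 2 = 0 ∧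
    Δ.L3 x w 0 1 1 0 = Δ.c * Δ.y * x * w ∧
    Δ.L3 x w 0 1 1 1 = 0 ∧
    Δ.L3 x w 0 1 1 2 = 0 ∧
    Δ.L3 x w 0 2 0 0 = 0 ∧
    Δ.L3 x w 0 2 0 1 = 0 ∧
    Δ.L3 x w 0 2 0 2 = Δ.p * x ^ 2 - Δ.q * w ^ 2 ∧
    Δ.L3 x w 0 2 1 0 = 0 ∧
    Δ.L3 x w 0 2 1 1 = Δ.c * Δ.y * x * w ∧
    Δ.L3 x w 0 2 1 2 = 0 ∧
    Δ.L3 x w 1 0 0 0 = 0 ∧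
    Δ.L3 x w 1 0 0 1 = Δ.c * Δ.y * x * w ∧
    Δ.L3 x w 1 0 0 2 = 0 ∧
    Δ.L3 x w 1 0 1 0 = Δ.p * x ^ 2 - Δ.q * w ^ 2 ∧
    Δ.L3 x w 1 0 1 1 = 0 ∧
    Δ.L3 x w 1 0 1 2 = 0 ∧
    Δ.L3 x w 1 1 0 0 = 0 ∧
    Δ.L3 x w 1 1 0 1 = 0 ∧
    Δ.L3 x w 1 1 0 2 = Δ.c * Δ.y * x * w ∧
    Δ.L3 x w 1 1 1 0 = 0 ∧
    Δ.L3 x w 1 1 1 1 = x ^ 2 - w ^ 2 ∧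
    Δ.L3 x w 1 1 1 2 = 0 ∧
    Δ.L3 x w 1 2 0 0 = 0 ∧
    Δ.L3 x w 1 2 0 1 = 0 ∧
    Δ.L3 x w 1 2 0 2 = 0 ∧
    Δ.L3 x w 1 2 1 0 = 0 ∧
    Δ.L3 x w 1 2 1 1 = 0 ∧
    Δ.L3 x w 1 2 1 2 = Δ.q * x ^ 2 - Δ.p * w ^ 2 := by
  and_intros <;> rfl

lemma I3_values (a b : ℝ) :
    Δ.I3 a b 0 0 0 0 = (Δ.q * a ^ 2 - Δ.p * b ^ 2) * (Δ.q ^ 2 * a ^ 2 - Δ.p ^ 2 * b ^ 2) ∧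
    Δ.I3 a b 0 0 0 1 = 0 ∧
    Δ.I3 a b 0 0 0 2 = 0 ∧
    Δ.I3 a b 0 0 1 0 = 0 ∧
    Δ.I3 a b 0 0 1 1 = 0 ∧
    Δ.I3 a b 0 0 1 2 = 0 ∧
    Δ.I3 a b 0 0 2 0 = 0 ∧
    Δ.I3 a b 0 0 2 1 = 0 ∧
    Δ.I3 a b 0 0 2 2 = 0 ∧
    Δ.I3 a b 0 1 0 0 = 0 ∧
    Δ.I3 a b 0 1 0 1 = ((Δ.q ^ 2 - Δ.p ^ 2) * a * b) * (Δ.q * a ^ 2 - Δ.p * b ^ 2) ∧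
    Δ.I3 a b 0 1 0 2 = 0 ∧
    Δ.I3 a b 0 1 1 0 = (a ^ 2 - b ^ 2) * (Δ.q * a ^ 2 - Δ.p * b ^ 2) ∧
    Δ.I3 a b 0 1 1 1 = 0 ∧
    Δ.I3 a b 0 1 1 2 = 0 ∧
    Δ.I3 a b 0 1 2 0 = 0 ∧
    Δ.I3 a b 0 1 2 1 = 0 ∧
    Δ.I3 a b 0 1 2 2 = 0 ∧
    Δ.I3 a b 0 2 0 0 = 0 ∧
    Δ.I3 a b 0 2 0 1 = 0 ∧
    Δ.I3 a b 0 2 0 2 = ((Δ.q - Δ.p) * a * b) * ((Δ.q ^ 2 - Δ.p ^ 2) * a * b) ∧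
    Δ.I3 a b 0 2 1 0 = 0 ∧
    Δ.I3 a b 0 2 1 1 = ((Δ.q ^ 2 - Δ.p ^ 2) * a * b) * (a ^ 2 - b ^ 2) ∧
    Δ.I3 a b 0 2 1 2 = 0 ∧
    Δ.I3 a b 0 2 2 0 = (a ^ 2 - b ^ 2) * (Δ.p * a ^ 2 - Δ.q * b ^ 2) ∧
    Δ.I3 a b 0 2 2 1 = 0 ∧
    Δ.I3 a b 0 2 2 2 = 0 ∧
    Δ.I3 a b 1 0 0 0 = 0 ∧
    Δ.I3 a b 1 0 0 1 = (a ^ 2 - b ^ 2) * (Δ.q * a ^ 2 - Δ.p * b ^ 2) ∧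
    Δ.I3 a b 1 0 0 2 = 0 ∧
    Δ.I3 a b 1 0 1 0 = ((Δ.q ^ 2 - Δ.p ^ 2) * a * b) * (Δ.q * a ^ 2 - Δ.p * b ^ 2) ∧
    Δ.I3 a b 1 0 1 1 = 0 ∧
    Δ.I3 a b 1 0 1 2 = 0 ∧
    Δ.I3 a b 1 0 2 0 = 0 ∧
    Δ.I3 a b 1 0 2 1 = 0 ∧
    Δ.I3 a b 1 0 2 2 = 0 ∧
    Δ.I3 a b 1 1 0 0 = 0 ∧
    Δ.I3 a b 1 1 0 1 = 0 ∧
    Δ.I3 a b 1 1 0 2 = ((Δ.q ^ 2 - Δ.p ^ 2) * a * b) * (a ^ 2 - b ^ 2) ∧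
    Δ.I3 a b 1 1 1 0 = 0 ∧
    Δ.I3 a b 1 1 1 1 = (a ^ 2 - b ^ 2) * (Δ.q * a ^ 2 - Δ.p * b ^ 2) + ((Δ.q - Δ.p) * a * b) * ((Δ.q ^ 2 - Δ.p ^ 2) * a * b) ∧
    Δ.I3 a b 1 1 1 2 = 0 ∧
    Δ.I3 a b 1 1 2 0 = ((Δ.q ^ 2 - Δ.p ^ 2) * a * b) * (a ^ 2 - b ^ 2) ∧
    Δ.I3 a b 1 1 2 1 = 0 ∧
    Δ.I3 a b 1 1 2 2 = 0 ∧
    Δ.I3 a b 1 2 0 0 = 0 ∧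
    Δ.I3 a b 1 2 0 1 = 0 ∧
    Δ.I3 a b 1 2 0 2 = 0 ∧
    Δ.I3 a b 1 2 1 0 = 0 ∧
    Δ.I3 a b 1 2 1 1 = 0 ∧
    Δ.I3 a b 1 2 1 2 = ((Δ.q ^ 2 - Δ.p ^ 2) * a * b) * (Δ.q * a ^ 2 - Δ.p * b ^ 2) ∧
    Δ.I3 a b 1 2 2 0 = 0 ∧
    Δ.I3 a b 1 2 2 1 = (a ^ 2 - b ^ 2) * (Δ.q * a ^ 2 - Δ.p * b ^ 2) ∧
    Δ.I3 a b 1 2 2 2 = 0 ∧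
    Δ.I3 a b 2 0 0 0 = 0 ∧
    Δ.I3 a b 2 0 0 1 = 0 ∧
    Δ.I3 a b 2 0 0 2 = (a ^ 2 - b ^ 2) * (Δ.p * a ^ 2 - Δ.q * b ^ 2) ∧
    Δ.I3 a b 2 0 1 0 = 0 ∧
    Δ.I3 a b 2 0 1 1 = ((Δ.q ^ 2 - Δ.p ^ 2) * a * b) * (a ^ 2 - b ^ 2) ∧
    Δ.I3 a b 2 0 1 2 = 0 ∧
    Δ.I3 a b 2 0 2 0 = ((Δ.q - Δ.p) * a * b) * ((Δ.q ^ 2 - Δ.p ^ 2) * a * b) ∧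
    Δ.I3 a b 2 0 2 1 = 0 ∧
    Δ.I3 a b 2 0 2 2 = 0 ∧
    Δ.I3 a b 2 1 0 0 = 0 ∧
    Δ.I3 a b 2 1 0 1 = 0 ∧
    Δ.I3 a b 2 1 0 2 = 0 ∧
    Δ.I3 a b 2 1 1 0 = 0 ∧
    Δ.I3 a b 2 1 1 1 = 0 ∧
    Δ.I3 a b 2 1 1 2 = (a ^ 2 - b ^ 2) * (Δ.q * a ^ 2 - Δ.p * b ^ 2) ∧
    Δ.I3 a b 2 1 2 0 = 0 ∧
    Δ.I3 a b 2 1 2 1 = ((Δ.q ^ 2 - Δ.p ^ 2) * a * b) * (Δ.q * a ^ 2 - Δ.p * b ^ 2) ∧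
    Δ.I3 a b 2 1 2 2 = 0 ∧
    Δ.I3 a b 2 2 0 0 = 0 ∧
    Δ.I3 a b 2 2 0 1 = 0 ∧
    Δ.I3 a b 2 2 0 2 = 0 ∧
    Δ.I3 a b 2 2 1 0 = 0 ∧
    Δ.I3 a b 2 2 1 1 = 0 ∧
    Δ.I3 a b 2 2 1 2 = 0 ∧
    Δ.I3 a b 2 2 2 0 = 0 ∧
    Δ.I3 a b 2 2 2 1 = 0 ∧
    Δ.I3 a b 2 2 2 2 = (Δ.q * a ^ 2 - Δ.p * b ^ 2) * (Δ.q ^ 2 * a ^ 2 - Δ.p ^ 2 * b ^ 2) := by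
  and_intros <;> rfl

lemma L3_eq_zero (x w : ℝ) (i : Fin 2) (s : Fin 3) (k : Fin 2) (t : Fin 3)
    (h : (i : ℕ) + s ≠ k + t) : Δ.L3 x w i s k t = 0 := by
  fin_cases i <;> fin_cases s <;> fin_cases k <;> fin_cases t <;> first | rfl | exact (h rfl).elim

lemma I3_eq_zero (a b : ℝ) (s₁ s₂ t₁ t₂ : Fin 3) (h : (s₁ : ℕ) + s₂ ≠ t₁ + t₂) :
    Δ.I3 a b s₁ s₂ t₁ t₂ = 0 := by
  fin_cases s₁ <;> fin_cases s₂ <;> fin_cases t₁ <;> fin_cases t₂ <;>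
    first | rfl | exact (h rfl).elim

set_option maxHeartbeats 40000000 in
lemma L3_column_exchange (a a' x : ℝ) : ∀ k r s₁ s₂ r₁ r₂,
    ∑ t₁, ∑ t₂, ∑ p, Δ.I3 a a' s₁ s₂ t₁ t₂ * (Δ.L3 x a p t₁ k r₁ * Δ.L3 x a' r t₂ p r₂) =
      ∑ t₁, ∑ t₂, ∑ p, Δ.L3 x a' p s₁ k t₁ * Δ.L3 x a r s₂ p t₂ * Δ.I3 a a' t₁ t₂ r₁ r₂ := by
  have h1 := Δ.q_mul_p
  have h2 := Δ.y_sq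
  intro k r s₁ s₂ r₁ r₂
  by_cases h : (r : ℕ) + s₁ + s₂ = k + r₁ + r₂
  · have hc : Δ.c = Δ.q - Δ.p := rfl
    simp only [Fin.sum_univ_two, Fin.sum_univ_three]
    fin_cases k <;> fin_cases r <;> fin_cases s₁ <;> fin_cases s₂ <;> fin_cases r₁ <;>
      fin_cases r₂ <;> first
      | exact absurd h (by decide)
      | simp only [Δ.L3_values, Δ.I3_values, Fin.mk_one, Fin.zero_eta, Fin.reduceFinMk, zero_mul,
          mul_zero, zero_add, add_zero]
        clear h
        grind
  · rw [Finset.sum_eq_zero fun t₁ _ => Finset.sum_eq_zero fun t₂ _ =>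
      Finset.sum_eq_zero fun p _ => ?_, Finset.sum_eq_zero fun t₁ _ => Finset.sum_eq_zero fun t₂ _ =>
      Finset.sum_eq_zero fun p _ => ?_]
    · by_contra h3
      simp only [mul_eq_zero, not_or] at h3
      have := mt (Δ.L3_eq_zero x a' p s₁ k t₁) h3.1.1
      have := mt (Δ.L3_eq_zero x a r s₂ p t₂) h3.1.2
      have := mt (Δ.I3_eq_zero a a' t₁ t₂ r₁ r₂) h3.2
      omega
    · by_contra h3
      simp only [mul_eq_zero, not_or] at h3
      have := mt (Δ.I3_eq_zero a a' s₁ s₂ t₁ t₂) h3.1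
      have := mt (Δ.L3_eq_zero x a p t₁ k r₁) h3.2.1
      have := mt (Δ.L3_eq_zero x a' r t₂ p r₂) h3.2.2
      omega

end Anis

namespace Anis

variable (Δ : Anis)

set_option maxHeartbeats 4000000 in
lemma L2_column_exchange (a a' x : ℝ) : ∀ k r s₁ s₂ r₁ r₂,
    ∑ t₁, ∑ t₂, ∑ p, Δ.I2 a a' s₁ s₂ t₁ t₂ * (Δ.L2 x a p t₁ k r₁ * Δ.L2 x a' r t₂ p r₂) =
      ∑ t₁, ∑ t₂, ∑ p, Δ.L2 x a' p s₁ k t₁ * Δ.L2 x a r s₂ p t₂ * Δ.I2 a a' t₁ t₂ r₁ r₂ := by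
  have h1 := Δ.q_mul_p
  intro k r s₁ s₂ r₁ r₂
  simp only [Fin.sum_univ_two, L2, I2, c]
  generalize Δ.q = q at *
  generalize Δ.p = p at *
  fin_cases k <;> fin_cases r <;> fin_cases s₁ <;> fin_cases s₂ <;> fin_cases r₁ <;>
    fin_cases r₂ <;> simp <;> grind

lemma bracket_two_pos {a b : ℝ} (ha : 1 ≤ a) (hb : 1 ≤ b) (hb' : b < Δ.q) :
    0 < Δ.q ^ 2 * a ^ 2 - Δ.p ^ 2 * b ^ 2 := by
  have h1 : Δ.p * b < 1 := by nlinarith [Δ.p_pos, Δ.q_mul_p]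
  have h2 : 0 < Δ.p * b := mul_pos Δ.p_pos (by linarith)
  have h3 : 1 < Δ.q * a := by nlinarith [Δ.one_lt]
  nlinarith

lemma bracket_one_pos {a b : ℝ} (ha : 1 ≤ a) (hb : 1 ≤ b) (hb' : b < Δ.q) :
    0 < Δ.q * a ^ 2 - Δ.p * b ^ 2 := by
  have h1 : Δ.p * b < 1 := by nlinarith [Δ.p_pos, Δ.q_mul_p]
  have h3 : Δ.q ≤ Δ.q * a ^ 2 := le_mul_of_one_le_right Δ.q_pos.le (one_le_pow₀ ha)
  nlinarith

lemma L3_colExchange {a b : ℝ} (ha : 1 ≤ a ∧ a < Δ.q) (hb : 1 ≤ b ∧ b < Δ.q) :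
    ColExchange Δ.L3 0 2 a b := by
  refine ⟨Δ.I3 a b, _, (mul_pos (Δ.bracket_one_pos ha.1 hb.1 hb.2)
    (Δ.bracket_two_pos ha.1 hb.1 hb.2)).ne', Δ.L3_column_exchange a b, ?_, ?_⟩
  · intro s₁ s₂
    fin_cases s₁ <;> fin_cases s₂ <;> simp [I3]
  · intro s₁ s₂
    fin_cases s₁ <;> fin_cases s₂ <;> simp [I3]

lemma L2_colExchange {a b : ℝ} (ha : 1 ≤ a ∧ a < Δ.q) (hb : 1 ≤ b ∧ b < Δ.q) :
    ColExchange Δ.L2 0 1 a b := by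
  refine ⟨Δ.I2 a b, _, (Δ.bracket_two_pos ha.1 hb.1 hb.2).ne', Δ.L2_column_exchange a b, ?_, ?_⟩
  · intro s₁ s₂
    fin_cases s₁ <;> fin_cases s₂ <;> simp [I2]
  · intro s₁ s₂
    fin_cases s₁ <;> fin_cases s₂ <;> simp [I2]

end Anis

/-! ### Comparison of the two domain wall partition functions -/

section RowPolynomial

variable {d : ℕ} {L : ℝ → ℝ → Wt d} {r t : Fin d} {e u v u' v' : ℝ → ℝ}

lemma cov_row_polynomial
    (hB : ∀ (n : ℕ) (ws : Fin (n + 1) → ℝ) (x : ℝ) (ψ : Sp d (n + 1)),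
      cov t (n + 1) (mB L ws x ψ) = x * e (ws 0) * cov t n (mA L (Fin.tail ws) x (sliceAt r ψ)) +
        (u (ws 0) * x ^ 2 + v (ws 0)) * cov t n (mB L (Fin.tail ws) x (sliceAt t ψ)))
    (hA : ∀ (n : ℕ) (ws : Fin (n + 1) → ℝ) (x : ℝ) (ψ : Sp d (n + 1)),
      cov t (n + 1) (mA L ws x ψ) =
        (u' (ws 0) * x ^ 2 + v' (ws 0)) * cov t n (mA L (Fin.tail ws) x (sliceAt t ψ)))
    (n : ℕ) (ws : Fin n → ℝ) (ψ : Sp d n) :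
    (∃ P : ℝ[X], P.degree < n ∧ ∀ x, cov t n (mB L ws x ψ) = x * P.eval (x ^ 2)) ∧
      ∃ Q : ℝ[X], Q.degree < (n + 1 : ℕ) ∧ ∀ x, cov t n (mA L ws x ψ) = Q.eval (x ^ 2) := by
  induction n with
  | zero =>
    refine ⟨⟨0, by simp, by simp [monodromy_zero]⟩, ⟨C (cov t 0 ψ), ?_, by simp [monodromy_zero]⟩⟩
    exact lt_of_le_of_lt degree_C_le (by norm_num)
  | succ n ih =>
    have hlin : ∀ a b : ℝ, (C a * X + C b).degree ≤ ((1 : ℕ) : WithBot ℕ) := fun a b => degree_linear_le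
    have hmul : ∀ (a b : ℝ) {P : ℝ[X]} {k : ℕ}, P.degree < (k : WithBot ℕ) →
        ((C a * X + C b) * P).degree < ((k + 1 : ℕ) : WithBot ℕ) := by
      intro a b P k hP
      refine (degree_mul_le _ _).trans_lt ?_
      rcases eq_or_ne P 0 with rfl | hP0
      · simp
      · rw [degree_eq_natDegree hP0] at hP ⊢
        have := hlin a b
        calc _ ≤ ((1 : ℕ) : WithBot ℕ) + (P.natDegree : WithBot ℕ) := by gcongr
          _ < _ := by norm_cast at hP ⊢; omega
    obtain ⟨P, hP, hP'⟩ := (ih (Fin.tail ws) (sliceAt t ψ)).1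
    obtain ⟨Q, hQ, hQ'⟩ := (ih (Fin.tail ws) (sliceAt t ψ)).2
    obtain ⟨Q₁, hQ₁, hQ₁'⟩ := (ih (Fin.tail ws) (sliceAt r ψ)).2
    refine ⟨⟨C (e (ws 0)) * Q₁ + (C (u (ws 0)) * X + C (v (ws 0))) * P, ?_, fun x => ?_⟩,
      ⟨(C (u' (ws 0)) * X + C (v' (ws 0))) * Q, hmul _ _ hQ, fun x => ?_⟩⟩
    · refine (degree_add_le _ _).trans_lt (max_lt ?_ (hmul _ _ hP))
      rw [← smul_eq_C_mul]
      exact (degree_smul_le _ _).trans_lt hQ₁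
    · rw [hB, hP', hQ₁']
      simp
      ring
    · rw [hA, hQ']
      simp

end RowPolynomial

namespace Anis

variable (Δ : Anis) {n : ℕ}

section Cov

variable (ws : Fin (n + 1) → ℝ) (x : ℝ) (ψ : Sp 3 (n + 1)) (χ : Sp 2 (n + 1))

lemma cov_succ_mB : cov 2 (n + 1) (mB Δ.L3 ws x ψ) =
    x * (Δ.c * Δ.y * ws 0) * cov 2 n (mA Δ.L3 (Fin.tail ws) x (sliceAt 1 ψ)) +
      (Δ.q * x ^ 2 + -(Δ.p * ws 0 ^ 2)) * cov 2 n (mB Δ.L3 (Fin.tail ws) x (sliceAt 2 ψ)) := by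
  rw [cov_succ, sliceAt_two_mB]
  simp only [map_add, map_smul, smul_eq_mul]
  ring

lemma cov_succ_mA : cov 2 (n + 1) (mA Δ.L3 ws x ψ) =
    (Δ.p * x ^ 2 + -(Δ.q * ws 0 ^ 2)) * cov 2 n (mA Δ.L3 (Fin.tail ws) x (sliceAt 2 ψ)) := by
  rw [cov_succ, sliceAt_two_mA]
  simp only [map_smul, smul_eq_mul]
  ring

lemma sliceAt_zero_mB_L2 : sliceAt 0 (mB Δ.L2 ws x χ) =
    (Δ.q * ws 0 ^ 2 - Δ.p * x ^ 2) • mB Δ.L2 (Fin.tail ws) x (sliceAt 0 χ) := by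
  simp [monodromy_succ, Fin.sum_univ_two, L2]

lemma cov_succ_mB_L2 : cov 1 (n + 1) (mB Δ.L2 ws x χ) =
    x * (Δ.c * (Δ.q + Δ.p) * ws 0) * cov 1 n (mA Δ.L2 (Fin.tail ws) x (sliceAt 0 χ)) +
      (Δ.q * x ^ 2 + -(Δ.p * ws 0 ^ 2)) * cov 1 n (mB Δ.L2 (Fin.tail ws) x (sliceAt 1 χ)) := by
  simp [cov_succ, monodromy_succ, Fin.sum_univ_two, L2]
  ring

lemma cov_succ_mA_L2 : cov 1 (n + 1) (mA Δ.L2 ws x χ) =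
    (-Δ.p * x ^ 2 + Δ.q * ws 0 ^ 2) * cov 1 n (mA Δ.L2 (Fin.tail ws) x (sliceAt 1 χ)) := by
  simp [cov_succ, monodromy_succ, Fin.sum_univ_two, L2]
  ring_nf
  simp

lemma sliceAt_zero_prod_mB_L2 (l : List ℝ) : sliceAt 0 ((l.map (mB Δ.L2 ws)).prod χ) =
    (l.map fun x => Δ.q * ws 0 ^ 2 - Δ.p * x ^ 2).prod •
      (l.map (mB Δ.L2 (Fin.tail ws))).prod (sliceAt 0 χ) := by
  induction l with
  | nil => simp
  | cons x l ih =>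
    simp only [List.map_cons, List.prod_cons, Module.End.mul_apply, sliceAt_zero_mB_L2, ih,
      map_smul, smul_smul]

end Cov

lemma cov_mA (ws : Fin n → ℝ) (x : ℝ) (ψ : Sp 3 n) : cov 2 n (mA Δ.L3 ws x ψ) =
    ((List.ofFn ws).map fun w => Δ.p * x ^ 2 - Δ.q * w ^ 2).prod * cov 2 n ψ := by
  induction n with
  | zero => simp [monodromy_zero]
  | succ n ih =>
    rw [cov_succ_mA, ih, ofFn_eq_cons_tail, List.map_cons, List.prod_cons, cov_succ]
    ring

lemma cov_mA_L2 (ws : Fin n → ℝ) (x : ℝ) (ψ : Sp 2 n) : cov 1 n (mA Δ.L2 ws x ψ) =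
    ((List.ofFn ws).map fun w => Δ.q * w ^ 2 - Δ.p * x ^ 2).prod * cov 1 n ψ := by
  induction n with
  | zero => simp [monodromy_zero]
  | succ n ih =>
    rw [cov_succ_mA_L2, ih, ofFn_eq_cons_tail, List.map_cons, List.prod_cons, cov_succ]
    ring

lemma mB_commute (ws : Fin n → ℝ) (x z : ℝ) : Commute (mB Δ.L3 ws x) (mB Δ.L3 ws z) := by
  by_cases h : x ≠ 0 ∨ z ≠ 0
  · exact Δ.mB_comm ws h
  · push Not at h
    rw [h.1, h.2]

lemma dwpf_perm (ws : Fin n → ℝ) {l l' : List ℝ} (h : l.Perm l') :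
    dwpf Δ.L3 0 2 ws l = dwpf Δ.L3 0 2 ws l' := by
  rw [dwpf, dwpf, (h.map (mB Δ.L3 ws)).prod_eq']
  rw [List.pairwise_map]
  exact List.pairwise_of_forall fun x z => Δ.mB_commute ws x z

lemma dwpf_recursion (ws : Fin (n + 1) → ℝ) (xs : List ℝ) :
    dwpf Δ.L3 0 2 ws (Δ.p * ws 0 :: (xs ++ List.ofFn ws)) =
      Δ.c ^ 2 * Δ.y ^ 2 * Δ.p * ws 0 ^ 4 *
        ((List.ofFn (Fin.tail ws)).map fun j => Δ.p * (Δ.p * ws 0) ^ 2 - Δ.q * j ^ 2).prod *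
        ((List.ofFn (Fin.tail ws)).map fun j => Δ.p * ws 0 ^ 2 - Δ.q * j ^ 2).prod *
        ((xs ++ List.ofFn (Fin.tail ws)).map fun x => Δ.p * x ^ 2 - Δ.q * ws 0 ^ 2).prod *
        dwpf Δ.L3 0 2 (Fin.tail ws) (xs ++ List.ofFn (Fin.tail ws)) := by
  have hperm : (Δ.p * ws 0 :: (xs ++ List.ofFn ws)).Perm
      (Δ.p * ws 0 :: ws 0 :: (xs ++ List.ofFn (Fin.tail ws))) := by
    rw [ofFn_eq_cons_tail ws]
    exact List.perm_middle.cons _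
  have h0 : Δ.q * (Δ.p * ws 0) ^ 2 + -(Δ.p * ws 0 ^ 2) = 0 := by
    linear_combination Δ.p * ws 0 ^ 2 * Δ.q_mul_p
  rw [Δ.dwpf_perm ws hperm, dwpf, List.map_cons, List.map_cons, List.prod_cons, List.prod_cons,
    Module.End.mul_apply, Module.End.mul_apply, cov_succ_mB, h0, sliceAt_one_mB,
    sliceAt_zero_prod_mB, sliceAt_vac]
  simp only [sub_self, zero_smul, add_zero, zero_mul, map_smul, cov_mA, smul_eq_mul, if_true, dwpf]
  ring

lemma dwpf_L2_recursion (ws : Fin (n + 1) → ℝ) (xs : List ℝ) :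
    dwpf Δ.L2 0 1 ws (Δ.p * ws 0 :: xs) =
      Δ.c * (Δ.q + Δ.p) * Δ.p * ws 0 ^ 2 *
        ((List.ofFn (Fin.tail ws)).map fun j => Δ.q * j ^ 2 - Δ.p * (Δ.p * ws 0) ^ 2).prod *
        (xs.map fun x => Δ.q * ws 0 ^ 2 - Δ.p * x ^ 2).prod * dwpf Δ.L2 0 1 (Fin.tail ws) xs := by
  have h0 : Δ.q * (Δ.p * ws 0) ^ 2 + -(Δ.p * ws 0 ^ 2) = 0 := by
    linear_combination Δ.p * ws 0 ^ 2 * Δ.q_mul_p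
  rw [dwpf, List.map_cons, List.prod_cons, Module.End.mul_apply, cov_succ_mB_L2, h0,
    sliceAt_zero_prod_mB_L2, sliceAt_vac]
  simp only [zero_mul, add_zero, map_smul, cov_mA_L2, smul_eq_mul, if_true, dwpf]
  ring

/-- The proportionality factor between the two domain wall partition functions. -/
def ratio : List ℝ → ℝ
  | [] => 1
  | w :: l => Δ.c * w ^ 2 *
      (l.map fun j => (Δ.p * j ^ 2 - Δ.q * w ^ 2) * (Δ.p * w ^ 2 - Δ.q * j ^ 2)).prod * ratio l

lemma ratio_perm {l l' : List ℝ} (h : l.Perm l') : Δ.ratio l = Δ.ratio l' := by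
  induction h with
  | nil => rfl
  | cons x h ih => rw [ratio, ratio, ih, (h.map _).prod_eq]
  | swap x y l =>
    simp only [ratio, List.map_cons, List.prod_cons]
    ring
  | trans _ _ h1 h2 => exact h1.trans h2

lemma prod_map_neg_sub (l : List ℝ) (f g : ℝ → ℝ) :
    (l.map fun x => f x - g x).prod = (-1) ^ l.length * (l.map fun x => g x - f x).prod := by
  induction l with
  | nil => simp
  | cons x l ih =>
    rw [List.map_cons, List.prod_cons, ih, List.map_cons, List.prod_cons, List.length_cons]
    ring

lemma dwpf_eq_ratio_mul {ws : Fin n → ℝ} (hg : Δ.Generic ws) (xs : List ℝ) (hxs : xs.length = n) :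
    dwpf Δ.L3 0 2 ws (xs ++ List.ofFn ws) = Δ.ratio (List.ofFn ws) * dwpf Δ.L2 0 1 ws xs := by
  induction n generalizing xs with
  | zero =>
    rw [List.length_eq_zero_iff.1 hxs]
    simp [dwpf, ratio, cov, vac, Subsingleton.elim (fun _ : Fin 0 => (2 : Fin 3)) (fun _ => 0),
      Subsingleton.elim (fun _ : Fin 0 => (1 : Fin 2)) (fun _ => 0)]
  | succ n ih =>
    obtain ⟨x, xs, rfl⟩ := List.exists_cons_of_length_eq_add_one hxs
    replace hxs : xs.length = n := by simpa using hxs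
    have hfirst : ∀ {ws : Fin (n + 1) → ℝ}, Δ.Generic ws →
        dwpf Δ.L3 0 2 ws (Δ.p * ws 0 :: (xs ++ List.ofFn ws)) =
          Δ.ratio (List.ofFn ws) * dwpf Δ.L2 0 1 ws (Δ.p * ws 0 :: xs) := by
      intro ws hg
      rw [dwpf_recursion, dwpf_L2_recursion, ih hg.tail xs hxs, ofFn_eq_cons_tail ws, ratio,
        prod_map_neg_sub _ (fun _ => Δ.p * (Δ.p * ws 0) ^ 2), List.map_append, List.prod_append,
        prod_map_neg_sub xs, List.prod_map_mul, Δ.y_sq, hxs, List.length_ofFn]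
      have h1 : ((-1 : ℝ) ^ n) * (-1) ^ n = 1 := by rw [← mul_pow]; simp
      linear_combination (Δ.c ^ 2 * (Δ.q + Δ.p) * Δ.p * ws 0 ^ 4 *
        ((List.ofFn (Fin.tail ws)).map fun j => Δ.q * j ^ 2 - Δ.p * (Δ.p * ws 0) ^ 2).prod *
        ((List.ofFn (Fin.tail ws)).map fun j => Δ.p * ws 0 ^ 2 - Δ.q * j ^ 2).prod *
        (xs.map fun x => Δ.q * ws 0 ^ 2 - Δ.p * x ^ 2).prod *
        ((List.ofFn (Fin.tail ws)).map fun j => Δ.p * j ^ 2 - Δ.q * ws 0 ^ 2).prod *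
        Δ.ratio (List.ofFn (Fin.tail ws)) * dwpf Δ.L2 0 1 (Fin.tail ws) xs) * h1
    have hall : ∀ j, dwpf Δ.L3 0 2 ws (Δ.p * ws j :: (xs ++ List.ofFn ws)) =
        Δ.ratio (List.ofFn ws) * dwpf Δ.L2 0 1 ws (Δ.p * ws j :: xs) := by
      intro j
      have hS : ∀ i, 1 ≤ ws i ∧ ws i < Δ.q := fun i => ⟨hg.one_le i, hg.lt_q i⟩
      have hp := ofFn_perm_cons_succAbove ws j
      have hg' : Δ.Generic (Fin.cons (ws j) fun i => ws (j.succAbove i) : Fin (n + 1) → ℝ) := by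
        refine ⟨fun i => ?_, fun i => ?_, ?_⟩
        · refine Fin.cases ?_ (fun i => ?_) i <;> simp [hg.one_le]
        · refine Fin.cases ?_ (fun i => ?_) i <;> simp [hg.lt_q]
        · rw [Fin.cons_injective_iff]
          refine ⟨?_, hg.inj.comp Fin.succAbove_right_injective⟩
          rintro ⟨i, hi⟩
          exact Fin.succAbove_ne j i (hg.inj hi)
      have hp' : (List.ofFn ws).Perm
          (List.ofFn (Fin.cons (ws j) fun i => ws (j.succAbove i) : Fin (n + 1) → ℝ)) := by
        rwa [ofFn_eq_cons_tail (Fin.cons _ _), Fin.cons_zero, Fin.tail_cons]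
      have h := hfirst hg'
      rw [Fin.cons_zero] at h
      rw [(Intertwined.bring_front (fun _ _ => Δ.L3_colExchange) ws hS j).dwpf_eq,
        (Intertwined.bring_front (fun _ _ => Δ.L2_colExchange) ws hS j).dwpf_eq,
        Δ.ratio_perm hp', ← h]
      exact Δ.dwpf_perm _ ((hp'.append_left xs).cons _)
    obtain ⟨P, hP, hP'⟩ := (cov_row_polynomial (u' := fun _ => Δ.p) (v' := fun w => -(Δ.q * w ^ 2))
      (u := fun _ => Δ.q) (v := fun w => -(Δ.p * w ^ 2)) (e := fun w => Δ.c * Δ.y * w)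
      (fun n => Δ.cov_succ_mB (n := n)) (fun n => Δ.cov_succ_mA (n := n)) (n + 1) ws
      (((xs ++ List.ofFn ws).map (mB Δ.L3 ws)).prod (vac 0 (n + 1)))).1
    obtain ⟨Q, hQ, hQ'⟩ := (cov_row_polynomial (u' := fun _ => -Δ.p) (v' := fun w => Δ.q * w ^ 2)
      (u := fun _ => Δ.q) (v := fun w => -(Δ.p * w ^ 2)) (e := fun w => Δ.c * (Δ.q + Δ.p) * w)
      (fun n => Δ.cov_succ_mB_L2 (n := n)) (fun n => Δ.cov_succ_mA_L2 (n := n)) (n + 1) ws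
      ((xs.map (mB Δ.L2 ws)).prod (vac 0 (n + 1)))).1
    have hP2 : ∀ x, dwpf Δ.L3 0 2 ws (x :: (xs ++ List.ofFn ws)) = x * P.eval (x ^ 2) := fun x => by
      rw [← hP', dwpf, List.map_cons, List.prod_cons, Module.End.mul_apply]
    have hQ2 : ∀ x, dwpf Δ.L2 0 1 ws (x :: xs) = x * Q.eval (x ^ 2) := fun x => by
      rw [← hQ', dwpf, List.map_cons, List.prod_cons, Module.End.mul_apply]
    have hPQ : P = C (Δ.ratio (List.ofFn ws)) * Q := by
      refine eq_of_degrees_lt_of_eval_index_eq (v := fun j => (Δ.p * ws j) ^ 2) Finset.univ ?_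
        (by simpa using hP) (by simpa [← smul_eq_C_mul] using (degree_smul_le _ _).trans_lt hQ) fun j _ => ?_
      · intro i _ j _ hij
        refine hg.inj (mul_left_cancel₀ Δ.p_pos.ne' ?_)
        exact (sq_eq_sq₀ (mul_pos Δ.p_pos (hg.pos i)).le (mul_pos Δ.p_pos (hg.pos j)).le).1 hij
      · have h := hall j
        rw [hP2, hQ2] at h
        refine mul_left_cancel₀ (mul_pos Δ.p_pos (hg.pos j)).ne' ?_
        rw [h, eval_mul, eval_C]
        ring
    rw [List.cons_append, hP2, hQ2, hPQ, eval_mul, eval_C]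
    ring

end Anis

/-! ### The homogeneous limit -/

section Continuity

variable {d n : ℕ} {T : Type*} [TopologicalSpace T] {L : ℝ → ℝ → Wt d}

lemma continuous_monodromy (hL : ∀ i s k t, Continuous fun v : ℝ × ℝ => L v.1 v.2 i s k t)
    {ws : T → Fin n → ℝ} {x : T → ℝ} {ψ : T → Sp d n} (hws : Continuous ws) (hx : Continuous x)
    (hψ : Continuous ψ) (i k : Fin 2) :
    Continuous fun τ => monodromy L n (ws τ) (x τ) i k (ψ τ) := by
  induction n generalizing i k with
  | zero =>
    simp only [monodromy_zero]
    split_ifs <;> simp [hψ, continuous_const]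
  | succ n ih =>
    have hslice : ∀ s, Continuous fun τ => sliceAt s (ψ τ) := fun s =>
      continuous_pi fun σ => (continuous_apply (Fin.cons s σ : Fin (n + 1) → Fin d)).comp hψ
    have htail : Continuous fun τ => (Fin.tail (ws τ) : Fin n → ℝ) :=
      continuous_pi fun j => (continuous_apply _).comp hws
    refine continuous_pi fun σ => ?_
    have h : ∀ τ, monodromy L (n + 1) (ws τ) (x τ) i k (ψ τ) σ =
        ∑ p, ∑ t, L (x τ) (ws τ 0) p (σ 0) k t *
          monodromy L n (Fin.tail (ws τ)) (x τ) i p (sliceAt t (ψ τ)) (Fin.tail σ) := by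
      intro τ
      simp [monodromy_succ, step, glue]
    simp only [h]
    refine continuous_finsetSum _ fun p _ => continuous_finsetSum _ fun t _ => Continuous.mul ?_ ?_
    · exact (hL p (σ 0) k t).comp (hx.prodMk ((continuous_apply 0).comp hws))
    · exact (continuous_apply _).comp (ih htail (hslice t) i p)

lemma continuous_prod_mB (hL : ∀ i s k t, Continuous fun v : ℝ × ℝ => L v.1 v.2 i s k t)
    {ws : T → Fin n → ℝ} (hws : Continuous ws) (b : Fin d) (xs : List (T → ℝ))
    (hxs : ∀ x ∈ xs, Continuous x) :
    Continuous fun τ => ((xs.map fun x => x τ).map (mB L (ws τ))).prod (vac b n) := by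
  induction xs with
  | nil => simpa using continuous_const
  | cons x xs ih =>
    simp only [List.map_cons, List.prod_cons, Module.End.mul_apply]
    exact continuous_monodromy hL hws (hxs x (by simp)) (ih fun z hz => hxs z (by simp [hz])) _ _

end Continuity

namespace Anis

variable (Δ : Anis) {n : ℕ}

lemma continuous_L3 (i : Fin 2) (s : Fin 3) (k : Fin 2) (t : Fin 3) :
    Continuous fun v : ℝ × ℝ => Δ.L3 v.1 v.2 i s k t := by
  fin_cases i <;> fin_cases s <;> fin_cases k <;> fin_cases t <;> simp [L3] <;> fun_prop

lemma continuous_L2 (i s k t : Fin 2) : Continuous fun v : ℝ × ℝ => Δ.L2 v.1 v.2 i s k t := by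
  fin_cases i <;> fin_cases s <;> fin_cases k <;> fin_cases t <;> simp [L2] <;> fun_prop

lemma eq_at_one_of_generic {f g : (Fin n → ℝ) → ℝ} (hf : Continuous f) (hg : Continuous g)
    (h : ∀ ws, Δ.Generic ws → f ws = g ws) : f 1 = g 1 := by
  let path : ℝ → Fin n → ℝ := fun τ j => τ ^ (j : ℕ)
  have hpath : Continuous path := by fun_prop
  have hpath1 : path 1 = 1 := by
    funext j
    simp [path]
  have hlt : ∀ᶠ τ in nhdsWithin (1 : ℝ) (Set.Ioi 1), ∀ j, path τ j < Δ.q := by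
    refine nhdsWithin_le_nhds (Filter.eventually_all.2 fun j => ?_)
    refine ((continuous_apply j).comp hpath).continuousAt.eventually_lt continuousAt_const ?_
    simpa [path] using Δ.one_lt
  have hgen : ∀ᶠ τ in nhdsWithin (1 : ℝ) (Set.Ioi 1), f (path τ) = g (path τ) := by
    filter_upwards [hlt, self_mem_nhdsWithin] with τ hτ hτ1
    exact h _ ⟨fun i => one_le_pow₀ (le_of_lt hτ1), hτ, fun i j hij =>
      Fin.ext (pow_right_injective₀ (zero_lt_one.trans hτ1) (ne_of_gt hτ1) hij)⟩
  rw [← hpath1]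
  exact tendsto_nhds_unique_of_eventuallyEq
    ((hf.comp hpath).continuousAt.tendsto.mono_left nhdsWithin_le_nhds)
    ((hg.comp hpath).continuousAt.tendsto.mono_left nhdsWithin_le_nhds) hgen

/-- The singlet of the homogeneous chain. -/
def homSinglet (n : ℕ) : Sp 3 n := (mB Δ.L3 (1 : Fin n → ℝ) 1 ^ n) (vac 0 n)

lemma ofFn_one : List.ofFn (1 : Fin n → ℝ) = List.replicate n 1 := List.ofFn_const n 1

lemma singlet_one : Δ.singlet (1 : Fin n → ℝ) = Δ.homSinglet n := by
  rw [singlet, ofFn_one, List.map_replicate, List.prod_replicate, homSinglet]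

lemma ofFn_eq_map_eval (ws : Fin n → ℝ) :
    List.ofFn ws = (List.ofFn fun (j : Fin n) (w : Fin n → ℝ) => w j).map fun x => x ws := by
  rw [List.map_ofFn]
  rfl

lemma continuous_singlet : Continuous fun ws : Fin n → ℝ => Δ.singlet ws := by
  have := continuous_prod_mB Δ.continuous_L3 (continuous_id (X := Fin n → ℝ)) 0
    (List.ofFn fun (j : Fin n) (w : Fin n → ℝ) => w j) (by
      intro x hx
      obtain ⟨j, rfl⟩ := List.mem_ofFn.1 hx
      exact continuous_apply j)
  simp only [← ofFn_eq_map_eval] at this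
  exact this

lemma spinFlip_homSinglet : spinFlip n (Δ.homSinglet n) = Δ.homSinglet n := by
  rw [← singlet_one]
  funext σ
  refine Δ.eq_at_one_of_generic (f := fun ws => spinFlip n (Δ.singlet ws) σ)
    (g := fun ws => Δ.singlet ws σ) ?_ ((continuous_apply σ).comp Δ.continuous_singlet) fun ws h => ?_
  · exact (continuous_apply fun j => Fin.rev (σ j)).comp Δ.continuous_singlet
  · exact congrFun (Δ.spinFlip_singlet h) σ

lemma ratio_replicate_one (n : ℕ) : Δ.ratio (List.replicate n 1) = Δ.c ^ n ^ 2 := by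
  induction n with
  | zero => simp [ratio]
  | succ n ih =>
    rw [List.replicate_succ, ratio, ih, List.map_replicate, List.prod_replicate]
    have : (Δ.p * 1 ^ 2 - Δ.q * 1 ^ 2) * (Δ.p * 1 ^ 2 - Δ.q * 1 ^ 2) = Δ.c ^ 2 := by
      rw [c]
      ring
    rw [this]
    ring

lemma continuous_ratio (xs : List ((Fin n → ℝ) → ℝ)) (hxs : ∀ x ∈ xs, Continuous x) :
    Continuous fun ws => Δ.ratio (xs.map fun x => x ws) := by
  induction xs with
  | nil => simpa [ratio] using continuous_const
  | cons x xs ih =>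
    simp only [List.map_cons, ratio, List.map_map]
    have hx := hxs x (by simp)
    refine (Continuous.mul (by fun_prop) (continuous_list_prod _ fun z hz => ?_)).mul
      (ih fun z hz => hxs z (by simp [hz]))
    have := hxs z (by simp [hz])
    simp only [Function.comp]
    fun_prop

lemma cov_hom_eq (n : ℕ) :
    cov 2 n ((mB Δ.L3 (1 : Fin n → ℝ) 1 ^ n) (Δ.homSinglet n)) =
      Δ.c ^ n ^ 2 * cov 1 n ((mB Δ.L2 (1 : Fin n → ℝ) 1 ^ n) (vac 0 n)) := by
  have hc : ∀ j : Fin n, Continuous fun w : Fin n → ℝ => w j := fun j => continuous_apply j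
  have hofn : ∀ x ∈ List.ofFn fun (j : Fin n) (w : Fin n → ℝ) => w j, Continuous x := by
    intro x hx
    obtain ⟨j, rfl⟩ := List.mem_ofFn.1 hx
    exact continuous_apply j
  have key := Δ.eq_at_one_of_generic (n := n)
    (f := fun ws => dwpf Δ.L3 0 2 ws (List.replicate n 1 ++ List.ofFn ws))
    (g := fun ws => Δ.ratio (List.ofFn ws) * dwpf Δ.L2 0 1 ws (List.replicate n 1))
    ?_ ?_ fun ws h => Δ.dwpf_eq_ratio_mul h _ (by simp)
  · simpa only [homSinglet, ofFn_one, ratio_replicate_one, dwpf, List.map_append, List.prod_append,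
      List.map_replicate, List.prod_replicate, Module.End.mul_apply] using key
  · have := continuous_prod_mB Δ.continuous_L3 (continuous_id (X := Fin n → ℝ)) 0
      (List.replicate n (fun _ => 1) ++ List.ofFn fun (j : Fin n) (w : Fin n → ℝ) => w j) (by
        intro x hx
        rcases List.mem_append.1 hx with hx | hx
        · rw [List.eq_of_mem_replicate hx]
          exact continuous_const
        · exact hofn x hx)
    simp only [List.map_append, List.map_replicate, ← ofFn_eq_map_eval] at this
    simp only [dwpf, List.map_append, List.map_replicate]
    exact (continuous_apply (fun _ : Fin n => (2 : Fin 3))).comp this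
  · refine Continuous.mul ?_ ?_
    · simpa only [← ofFn_eq_map_eval] using Δ.continuous_ratio _ hofn
    · have := continuous_prod_mB Δ.continuous_L2 (continuous_id (X := Fin n → ℝ)) 0
        (List.replicate n (fun _ => 1)) (by
          intro x hx
          rw [List.eq_of_mem_replicate hx]
          exact continuous_const)
      simp only [List.map_replicate] at this
      simp only [dwpf, List.map_replicate]
      exact (continuous_apply (fun _ : Fin n => (1 : Fin 2))).comp this

end Anis

/-! ### The square norm of the homogeneous singlet -/

lemma sum_fin_cons {M α : Type*} [AddCommMonoid M] [Fintype α] {n : ℕ}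
    (g : (Fin (n + 1) → α) → M) :
    ∑ τ, g τ = ∑ t, ∑ τ : Fin n → α, g (Fin.cons t τ : Fin (n + 1) → α) := by
  rw [← Fintype.sum_prod_type']
  exact (Fintype.sum_equiv (Fin.consEquiv fun _ => α) _ _ fun _ => rfl).symm

section Pairing

variable {d n : ℕ}

/-- The standard bilinear pairing of states. -/
def pairing (ψ χ : Sp d n) : ℝ := ∑ σ, ψ σ * χ σ

lemma pairing_succ (ψ χ : Sp d (n + 1)) :
    pairing ψ χ = ∑ s, pairing (sliceAt s ψ) (sliceAt s χ) := by
  simp only [pairing, sum_fin_cons, sliceAt_apply]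

lemma pairing_sum_left {ι : Type*} (s : Finset ι) (f : ι → Sp d n) (χ : Sp d n) :
    pairing (∑ i ∈ s, f i) χ = ∑ i ∈ s, pairing (f i) χ := by
  simp only [pairing, Finset.sum_apply, Finset.sum_mul]
  exact Finset.sum_comm

lemma pairing_sum_right {ι : Type*} (s : Finset ι) (f : ι → Sp d n) (χ : Sp d n) :
    pairing χ (∑ i ∈ s, f i) = ∑ i ∈ s, pairing χ (f i) := by
  simp only [pairing, Finset.sum_apply, Finset.mul_sum]
  exact Finset.sum_comm

lemma pairing_smul_left (a : ℝ) (ψ χ : Sp d n) : pairing (a • ψ) χ = a * pairing ψ χ := by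
  simp only [pairing, Pi.smul_apply, smul_eq_mul, Finset.mul_sum, mul_assoc]

lemma pairing_smul_right (a : ℝ) (ψ χ : Sp d n) : pairing ψ (a • χ) = a * pairing ψ χ := by
  simp only [pairing, Pi.smul_apply, smul_eq_mul, Finset.mul_sum, mul_left_comm]

lemma pairing_vac (b : Fin d) (χ : Sp d n) : pairing (vac b n) χ = cov b n χ := by
  simp [pairing, vac, cov, Pi.single_apply]

end Pairing

namespace Anis

variable (Δ : Anis) {n : ℕ}

lemma L3_one_transpose (i p : Fin 2) (s : Fin 3) (k : Fin 2) (t : Fin 3) :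
    (if i = p then 1 else -1) * Δ.L3 1 1 p s k t =
      -((if i = k then 1 else -1) * Δ.L3 1 1 (Fin.rev p) t (Fin.rev k) s) := by
  fin_cases i <;> fin_cases p <;> fin_cases k <;> fin_cases s <;> fin_cases t <;> simp [L3]

lemma pairing_monodromy (i k : Fin 2) (ψ χ : Sp 3 n) :
    pairing (monodromy Δ.L3 n 1 1 i k ψ) χ =
      (-1) ^ n * (if i = k then 1 else -1) *
        pairing ψ (monodromy Δ.L3 n 1 1 (Fin.rev i) (Fin.rev k) χ) := by
  induction n generalizing i k with
  | zero => by_cases h : i = k <;> simp [monodromy_zero, h, pairing]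
  | succ n ih =>
    have htail : Fin.tail (1 : Fin (n + 1) → ℝ) = 1 := rfl
    simp only [pairing_succ, monodromy_succ, sliceAt_step, pairing_sum_left, pairing_sum_right,
      pairing_smul_left, pairing_smul_right, htail, Pi.one_apply, ih, Finset.mul_sum]
    rw [Finset.sum_comm]
    conv_rhs => rw [Finset.sum_comm]
    rw [← Equiv.sum_comp Fin.revPerm]
    refine Finset.sum_congr rfl fun p _ => ?_
    rw [Finset.sum_comm]
    refine Finset.sum_congr rfl fun t _ => Finset.sum_congr rfl fun s _ => ?_
    have := Δ.L3_one_transpose i (Fin.rev p) s k t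
    rw [Fin.rev_rev] at this
    simp only [Fin.revPerm_apply, Fin.rev_rev]
    linear_combination ((-1) ^ n *
      pairing (sliceAt t ψ) (monodromy Δ.L3 n 1 1 (Fin.rev i) p (sliceAt s χ))) * this

lemma pairing_mC_pow (m : ℕ) (ψ χ : Sp 3 n) :
    pairing ((mC Δ.L3 1 1 ^ m) ψ) χ = (-1) ^ ((n + 1) * m) * pairing ψ ((mB Δ.L3 1 1 ^ m) χ) := by
  induction m generalizing χ with
  | zero => simp
  | succ m ih =>
    rw [pow_succ', Module.End.mul_apply, pairing_monodromy, show Fin.rev (1 : Fin 2) = 0 from rfl,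
      show Fin.rev (0 : Fin 2) = 1 from rfl, ih, pow_succ (mB Δ.L3 1 1), Module.End.mul_apply]
    simp
    ring

lemma spinFlip_mB_pow (m : ℕ) (ψ : Sp 3 n) :
    spinFlip n ((mB Δ.L3 1 1 ^ m) ψ) = (mC Δ.L3 1 1 ^ m) (spinFlip n ψ) := by
  induction m with
  | zero => simp
  | succ m ih =>
    rw [pow_succ', Module.End.mul_apply, spinFlip_monodromy, ih, pow_succ', Module.End.mul_apply]
    rfl

lemma spinFlip_vac : spinFlip n (vac 0 n) = vac 2 n := by
  funext σ
  have : (fun j => Fin.rev (σ j)) = (fun _ => 0) ↔ σ = fun _ => 2 := by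
    simp only [funext_iff]
    refine forall_congr' fun j => ?_
    generalize σ j = s
    fin_cases s <;> decide
  simp [spinFlip, LinearMap.funLeft_apply, vac, Pi.single_apply, this]

lemma cov_mB_pow_homSinglet :
    cov 2 n ((mB Δ.L3 1 1 ^ n) (Δ.homSinglet n)) = ∑ σ, Δ.homSinglet n σ ^ 2 := by
  have h := Δ.pairing_mC_pow n (vac 2 n) (Δ.homSinglet n)
  have hsign : (-1 : ℝ) ^ ((n + 1) * n) = 1 := by
    rw [mul_comm]
    exact (Nat.even_mul_succ_self n).neg_one_pow
  rw [← spinFlip_vac, ← spinFlip_mB_pow, ← homSinglet, spinFlip_homSinglet, spinFlip_vac,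
    pairing_vac, hsign, one_mul] at h
  rw [← h]
  exact Finset.sum_congr rfl fun σ _ => (sq _).symm

/-- The square norm of the homogeneous singlet is a six-vertex partition function. -/
lemma sum_homSinglet_sq : ∑ σ, Δ.homSinglet n σ ^ 2 =
    Δ.c ^ n ^ 2 * cov 1 n ((mB Δ.L2 (1 : Fin n → ℝ) 1 ^ n) (vac 0 n)) := by
  rw [← cov_mB_pow_homSinglet, cov_hom_eq]

end Anis

/-! ### The monodromy of copies of `rho` -/

section Rho

variable {n : ℕ}

/-- The product of the copies of `rho` over a list of sites. -/
abbrev rhoProd (l : List (Fin n)) :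
    Matrix (Fin 2 × (Fin n → Fin 3)) (Fin 2 × (Fin n → Fin 3)) ℤ[X] :=
  (l.map fun j => rhoAt j).prod

lemma rhoAt_succ (j : Fin n) (ε ε' : Fin 2) (s t : Fin 3) (σ τ : Fin n → Fin 3) :
    rhoAt j.succ (ε, (Fin.cons s σ : Fin (n + 1) → Fin 3))
      (ε', (Fin.cons t τ : Fin (n + 1) → Fin 3)) =
      if s = t then rhoAt j (ε, σ) (ε', τ) else 0 := by
  by_cases h : s = t <;>
    simp [rhoAt, Fin.forall_fin_succ, h, (Fin.succ_ne_zero j).symm]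

lemma rhoAt_zero (ε ε' : Fin 2) (s t : Fin 3) (σ τ : Fin n → Fin 3) :
    rhoAt 0 (ε, (Fin.cons s σ : Fin (n + 1) → Fin 3))
      (ε', (Fin.cons t τ : Fin (n + 1) → Fin 3)) =
      if σ = τ then rho (ε, s) (ε', t) else 0 := by
  simp [rhoAt, Fin.forall_fin_succ, funext_iff]

lemma rhoProd_map_succ (l : List (Fin n)) (ε ε' : Fin 2) (s t : Fin 3) (σ τ : Fin n → Fin 3) :
    rhoProd (l.map Fin.succ) (ε, (Fin.cons s σ : Fin (n + 1) → Fin 3))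
      (ε', (Fin.cons t τ : Fin (n + 1) → Fin 3)) =
      if s = t then rhoProd l (ε, σ) (ε', τ) else 0 := by
  induction l generalizing ε s σ with
  | nil =>
    by_cases h : s = t <;> simp [rhoProd, Matrix.one_apply, h, Fin.cons_inj]
  | cons j l ih =>
    simp only [rhoProd, List.map_cons, List.prod_cons, Matrix.mul_apply] at ih ⊢
    rw [Fintype.sum_prod_type]
    simp only [sum_fin_cons, ih, rhoAt_succ]
    by_cases h : s = t
    · simp [h, Fintype.sum_prod_type]
    · simp [h]

lemma rhoProd_finRange_succ (ε ε' : Fin 2) (s t : Fin 3) (σ τ : Fin n → Fin 3) :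
    rhoProd (List.finRange (n + 1)).reverse (ε, (Fin.cons s σ : Fin (n + 1) → Fin 3))
      (ε', (Fin.cons t τ : Fin (n + 1) → Fin 3)) =
      ∑ κ, rhoProd (List.finRange n).reverse (ε, σ) (κ, τ) * rho (κ, s) (ε', t) := by
  have h : rhoProd (List.finRange (n + 1)).reverse =
      rhoProd ((List.finRange n).reverse.map Fin.succ) * rhoAt 0 := by
    simp [rhoProd, List.finRange_succ]
  rw [h, Matrix.mul_apply, Fintype.sum_prod_type]
  simp only [sum_fin_cons, rhoProd_map_succ, rhoAt_zero]
  simp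

end Rho

namespace Anis

variable (Δ : Anis) {n : ℕ}

lemma L3_one_eq_rho (p : Fin 2) (s : Fin 3) (k : Fin 2) (t : Fin 3) :
    Δ.L3 1 1 p s k t = Δ.c * aeval Δ.y (rho (p, s) (k, t)) := by
  fin_cases p <;> fin_cases s <;> fin_cases k <;> fin_cases t <;> simp [L3, rho, c]

lemma monodromy_one_apply (i k : Fin 2) (ψ : Sp 3 n) (σ : Fin n → Fin 3) :
    monodromy Δ.L3 n 1 1 i k ψ σ =
      Δ.c ^ n * ∑ τ, aeval Δ.y (rhoProd (List.finRange n).reverse (i, σ) (k, τ)) * ψ τ := by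
  induction n generalizing i k with
  | zero =>
    by_cases h : i = k
    · simp [rhoProd, monodromy_zero, h, Matrix.one_apply]
      exact fun hσ => (hσ (Subsingleton.elim _ _)).elim
    · simp [rhoProd, monodromy_zero, h]
  | succ n ih =>
    have htail : Fin.tail (1 : Fin (n + 1) → ℝ) = 1 := rfl
    obtain ⟨s, σ, rfl⟩ : ∃ s σ', σ = (Fin.cons s σ' : Fin (n + 1) → Fin 3) :=
      ⟨σ 0, Fin.tail σ, (Fin.cons_self_tail σ).symm⟩
    rw [← sliceAt_apply s (monodromy Δ.L3 (n + 1) 1 1 i k ψ) σ, monodromy_succ, sliceAt_step, sum_fin_cons]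
    simp only [rhoProd_finRange_succ, Finset.sum_apply, Pi.smul_apply, smul_eq_mul, htail,
      Pi.one_apply, ih, L3_one_eq_rho, sliceAt_apply, map_sum, map_mul, Finset.sum_mul,
      Finset.mul_sum]
    rw [Finset.sum_comm]
    refine Finset.sum_congr rfl fun t _ => ?_
    rw [Finset.sum_comm]
    refine Finset.sum_congr rfl fun τ _ => Finset.sum_congr rfl fun p _ => ?_
    ring

lemma mB_pow_vac_apply (m : ℕ) (σ : Fin n → Fin 3) :
    (mB Δ.L3 (1 : Fin n → ℝ) 1 ^ m) (vac 0 n) σ =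
      Δ.c ^ (n * m) * aeval Δ.y (((betaMat n ^ m).mulVec (vacP n)) σ) := by
  induction m generalizing σ with
  | zero =>
    by_cases h : σ = fun _ => 0 <;> simp [vac, vacP, h]
  | succ m ih =>
    rw [pow_succ', Module.End.mul_apply, monodromy_one_apply, pow_succ' (betaMat n),
      ← Matrix.mulVec_mulVec]
    conv_rhs => rw [Matrix.mulVec, dotProduct]
    simp only [map_sum, map_mul, ih, Finset.mul_sum]
    refine Finset.sum_congr rfl fun τ _ => ?_
    rw [show betaMat n σ τ = rhoProd (List.finRange n).reverse (0, σ) (1, τ) from rfl]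
    ring

lemma homSinglet_apply (σ : Fin n → Fin 3) :
    Δ.homSinglet n σ = Δ.c ^ n ^ 2 * aeval Δ.y (_root_.comp n σ) := by
  rw [homSinglet, mB_pow_vac_apply, ← sq]
  rfl

end Anis

/-! ### The six-vertex partition function and alternating sign matrices -/

section Confined

/-- The nonzero entries of `v` alternate in sign. -/
def Alternates {n : ℕ} (v : Fin n → ℤ) : Prop :=
  ∀ j₁ j₂ : Fin n, j₁ < j₂ → v j₁ ≠ 0 → v j₂ ≠ 0 →
    (∀ k, j₁ < k → k < j₂ → v k = 0) → v j₂ = -v j₁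

/-- The first nonzero entry of `v`, if any, is `a`. -/
def FirstNonzero {n : ℕ} (a : ℤ) (v : Fin n → ℤ) : Prop :=
  ∀ j, v j ≠ 0 → (∀ k, k < j → v k = 0) → v j = a

/-- The nonzero entries of `v` alternate in sign, the first one being `1 - 2 * s`. -/
def AlternatesFrom {n : ℕ} (s : ℤ) (v : Fin n → ℤ) : Prop :=
  Alternates v ∧ FirstNonzero (1 - 2 * s) v

/-- All partial sums of `v`, shifted by `s`, belong to `{0, 1}`, and the last one is `1`. -/
def Confined : {n : ℕ} → ℤ → (Fin n → ℤ) → Prop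
  | 0, s, _ => s = 1
  | _ + 1, s, v => (s = 0 ∨ s = 1) ∧ Confined (s + v 0) (Fin.tail v)

variable {n : ℕ}

lemma Confined.zero_or_one {s : ℤ} {v : Fin n → ℤ} (h : Confined s v) : s = 0 ∨ s = 1 := by
  cases n with
  | zero => exact Or.inr h
  | succ n => exact h.1

lemma firstNonzero_succ_iff (a : ℤ) (v : Fin (n + 1) → ℤ) :
    FirstNonzero a v ↔ (v 0 ≠ 0 → v 0 = a) ∧ (v 0 = 0 → FirstNonzero a (Fin.tail v)) := by
  simp only [FirstNonzero, Fin.forall_fin_succ, Fin.tail, Fin.succ_pos, Fin.succ_lt_succ_iff,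
    Fin.not_lt_zero, false_imp_iff, implies_true, and_true, true_imp_iff]
  tauto

lemma alternates_succ_iff (v : Fin (n + 1) → ℤ) :
    Alternates v ↔ (v 0 ≠ 0 → FirstNonzero (-v 0) (Fin.tail v)) ∧ Alternates (Fin.tail v) := by
  simp only [Alternates, FirstNonzero, Fin.forall_fin_succ, Fin.tail, Fin.succ_pos,
    Fin.succ_lt_succ_iff, Fin.not_lt_zero, false_imp_iff, implies_true, true_imp_iff, true_and]
  tauto

lemma alternatesFrom_succ_iff {s : ℤ} (hs : s = 0 ∨ s = 1) {v : Fin (n + 1) → ℤ}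
    (hv : v 0 = -1 ∨ v 0 = 0 ∨ v 0 = 1) :
    AlternatesFrom s v ↔ (s + v 0 = 0 ∨ s + v 0 = 1) ∧ AlternatesFrom (s + v 0) (Fin.tail v) := by
  simp only [AlternatesFrom, alternates_succ_iff, firstNonzero_succ_iff]
  rcases hs with rfl | rfl <;> rcases hv with h | h | h <;> simp [h, and_comm]

lemma AlternatesFrom.add_sum {s : ℤ} (hs : s = 0 ∨ s = 1) {v : Fin n → ℤ}
    (hv : ∀ j, v j = -1 ∨ v j = 0 ∨ v j = 1) (h : AlternatesFrom s v) :
    s + ∑ j, v j = 0 ∨ s + ∑ j, v j = 1 := by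
  induction n generalizing s with
  | zero => simpa using hs
  | succ n ih =>
    rw [alternatesFrom_succ_iff hs (hv 0)] at h
    have := ih h.1 (fun j => hv j.succ) h.2
    rwa [Fin.sum_univ_succ, ← add_assoc]

lemma confined_iff {s : ℤ} (hs : s = 0 ∨ s = 1) {v : Fin n → ℤ}
    (hv : ∀ j, v j = -1 ∨ v j = 0 ∨ v j = 1) :
    Confined s v ↔ AlternatesFrom s v ∧ s + ∑ j, v j = 1 := by
  induction n generalizing s with
  | zero => simp [Confined, AlternatesFrom, Alternates, FirstNonzero]
  | succ n ih =>
    rw [alternatesFrom_succ_iff hs (hv 0), Fin.sum_univ_succ, ← add_assoc, Confined, and_assoc]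
    refine ⟨fun h => ?_, fun h => ⟨hs, (ih h.1 fun j => hv j.succ).2 h.2⟩⟩
    exact ⟨h.2.zero_or_one, (ih h.2.zero_or_one fun j => hv j.succ).1 h.2⟩

lemma confined_zero_iff {v : Fin n → ℤ} (hv : ∀ j, v j = -1 ∨ v j = 0 ∨ v j = 1) :
    Confined 0 v ↔ ∑ j, v j = 1 ∧ Alternates v := by
  rw [confined_iff (Or.inl rfl) hv, zero_add, and_comm]
  refine and_congr_right fun hsum => ⟨fun h => h.1, fun h => ?_⟩
  have hor : AlternatesFrom 0 v ∨ AlternatesFrom 1 v := by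
    by_contra! hcon
    simp only [AlternatesFrom, FirstNonzero, h, true_and, not_forall] at hcon
    obtain ⟨⟨i, hi, hi', hi''⟩, ⟨j, hj, hj', hj''⟩⟩ := hcon
    obtain rfl : i = j := by
      rcases lt_trichotomy i j with hij | hij | hij
      · exact (hi (hj' i hij)).elim
      · exact hij
      · exact (hj (hi' j hij)).elim
    rcases hv i with h | h | h <;> simp_all
  refine hor.resolve_right fun h1 => ?_
  have := h1.add_sum (Or.inr rfl) hv
  omega

end Confined

/-- The integer value of an encoded matrix entry. -/
abbrev entry : Fin 3 → ℤ := ![-1, 0, 1]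

lemma entry_cases (a : Fin 3) : entry a = -1 ∨ entry a = 0 ∨ entry a = 1 := by
  fin_cases a <;> simp [entry]

lemma isASM_toMat_iff {N : ℕ} (f : Fin N → Fin N → Fin 3) :
    IsASM (toMat f) ↔ (∀ i, Confined 0 fun j => entry (f i j)) ∧
      ∀ j, Confined 0 fun i => entry (f i j) := by
  simp only [confined_zero_iff fun _ => entry_cases _, forall_and]
  constructor
  · rintro ⟨-, h1, h2, h3, h4⟩
    exact ⟨⟨h1, h3⟩, h2, h4⟩
  · rintro ⟨⟨h1, h3⟩, h2, h4⟩
    exact ⟨fun i j => entry_cases (f i j), h1, h2, h3, h4⟩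

section Indicator

/-- The indicator of a transition between two partial sums. -/
def transition (s : Fin 2) (a : Fin 3) (s' : Fin 2) : ℝ :=
  if (s' : ℤ) = s + entry a then 1 else 0

open scoped Classical in
/-- The indicator of confined sequences. -/
def confinedInd {n : ℕ} (s : Fin 2) (f : Fin n → Fin 3) : ℝ :=
  if Confined (s : ℤ) (fun j => entry (f j)) then 1 else 0

variable {n : ℕ}

lemma confinedInd_zero (s : Fin 2) (f : Fin 0 → Fin 3) :
    confinedInd s f = if s = 1 then 1 else 0 := by
  fin_cases s <;> simp [confinedInd, Confined]

lemma confinedInd_cons (s : Fin 2) (a : Fin 3) (f : Fin n → Fin 3) :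
    confinedInd s (Fin.cons a f : Fin (n + 1) → Fin 3) =
      ∑ s', transition s a s' * confinedInd s' f := by
  classical
  have hs : (s : ℤ) = 0 ∨ (s : ℤ) = 1 := by fin_cases s <;> simp
  have hcons : Confined (s : ℤ) (fun j => entry ((Fin.cons a f : Fin (n + 1) → Fin 3) j)) ↔
      Confined (s + entry a : ℤ) (fun j => entry (f j)) := ⟨fun h => h.2, fun h => ⟨hs, h⟩⟩
  have hL : confinedInd s (Fin.cons a f : Fin (n + 1) → Fin 3) =
      if Confined (s + entry a : ℤ) (fun j => entry (f j)) then 1 else 0 := if_congr hcons rfl rfl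
  rw [hL, Fin.sum_univ_two]
  simp only [confinedInd, transition]
  by_cases h : (s : ℤ) + entry a = 0 ∨ (s : ℤ) + entry a = 1
  · rcases h with h | h <;> simp [h]
  · have h' : ¬ Confined ((s : ℤ) + entry a) (fun j => entry (f j)) := fun hc => h hc.zero_or_one
    push Not at h
    simp [h', h.1.symm, h.2.symm]

end Indicator

section RowWeights

variable {n : ℕ}

/-- The weight of a matrix entry: `u` if it is nonzero. -/
def entryWeight (u : ℝ) (a : Fin 3) : ℝ := if a = 1 then 1 else u

namespace Anis

variable (Δ : Anis)

lemma L2_one_eq (p s k t : Fin 2) : Δ.L2 1 1 p s k t =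
    Δ.c * ∑ a, transition (Fin.rev k) a (Fin.rev p) * transition t a s *
      entryWeight (Δ.q + Δ.p) a := by
  fin_cases p <;> fin_cases s <;> fin_cases k <;> fin_cases t <;>
    simp [L2, c, transition, entryWeight, Fin.sum_univ_three]

lemma monodromy_L2_one_apply (k : Fin 2) (ψ : Sp 2 n) (σ : Fin n → Fin 2) :
    monodromy Δ.L2 n 1 1 0 k ψ σ = Δ.c ^ n * ∑ τ, ∑ f : Fin n → Fin 3,
      confinedInd (Fin.rev k) f *
        (∏ j, transition (τ j) (f j) (σ j) * entryWeight (Δ.q + Δ.p) (f j)) * ψ τ := by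
  induction n generalizing k with
  | zero =>
    have h : ∀ τ, ψ τ = ψ σ := fun τ => congrArg ψ (Subsingleton.elim _ _)
    fin_cases k <;> simp [monodromy_zero, confinedInd_zero, h]
  | succ n ih =>
    have htail : Fin.tail (1 : Fin (n + 1) → ℝ) = 1 := rfl
    obtain ⟨s, σ, rfl⟩ : ∃ s σ', σ = (Fin.cons s σ' : Fin (n + 1) → Fin 2) :=
      ⟨σ 0, Fin.tail σ, (Fin.cons_self_tail σ).symm⟩
    rw [← sliceAt_apply s (monodromy Δ.L2 (n + 1) 1 1 0 k ψ) σ, monodromy_succ, sliceAt_step,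
      sum_fin_cons]
    simp only [Finset.sum_apply, Pi.smul_apply, smul_eq_mul, htail, Pi.one_apply, ih, sum_fin_cons,
      confinedInd_cons, Fin.prod_univ_succ, Fin.cons_zero, Fin.cons_succ, sliceAt_apply, L2_one_eq]
    rw [Finset.sum_comm, Finset.mul_sum]
    refine Finset.sum_congr rfl fun t _ => ?_
    simp only [Finset.mul_sum, Finset.sum_mul]
    rw [Finset.sum_comm]
    refine Finset.sum_congr rfl fun τ _ => ?_
    rw [← Equiv.sum_comp Fin.revPerm]
    simp only [Fin.revPerm_apply, Fin.rev_rev]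
    rw [Finset.sum_comm' (t' := Finset.univ) (s' := fun _ => Finset.univ) (by simp)]
    conv_lhs => enter [2, f]; rw [Finset.sum_comm]
    rw [Finset.sum_comm]
    refine Finset.sum_congr rfl fun a _ => Finset.sum_congr rfl fun f _ =>
      Finset.sum_congr rfl fun p _ => ?_
    ring

/-- Rows acting on a chain produce sums over matrices with confined rows and columns. -/
lemma cov_mB_L2_pow (m : ℕ) (ψ : Sp 2 n) :
    cov 1 n ((mB Δ.L2 (1 : Fin n → ℝ) 1 ^ m) ψ) =
      Δ.c ^ (n * m) * ∑ f : Fin m → Fin n → Fin 3, ∑ τ,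
        (∏ i, confinedInd 0 (f i) * ∏ j, entryWeight (Δ.q + Δ.p) (f i j)) *
          (∏ j, confinedInd (τ j) fun i => f i j) * ψ τ := by
  induction m generalizing ψ with
  | zero =>
    have h : ∀ τ : Fin n → Fin 2, (∏ j, if τ j = 1 then (1 : ℝ) else 0) =
        if τ = fun _ => 1 then 1 else 0 := by
      intro τ
      rw [Finset.prod_ite_zero]
      simp [funext_iff]
    simp [confinedInd_zero, h, cov]
  | succ m ih =>
    have hcol : ∀ (r : Fin n → Fin 3) (f : Fin m → Fin n → Fin 3) (τ : Fin n → Fin 2),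
        (∏ j, confinedInd (τ j) fun i => (Fin.cons r f : Fin (m + 1) → Fin n → Fin 3) i j) =
          ∑ σ : Fin n → Fin 2, ∏ j, (transition (τ j) (r j) (σ j) *
            confinedInd (σ j) fun i => f i j) := by
      intro r f τ
      have h : ∀ j, (fun i => (Fin.cons r f : Fin (m + 1) → Fin n → Fin 3) i j) =
          (Fin.cons (r j) fun i => f i j : Fin (m + 1) → Fin 3) := by
        intro j
        funext i
        refine Fin.cases ?_ (fun _ => ?_) i <;> simp
      simp only [h, confinedInd_cons, Finset.prod_univ_sum, Fintype.piFinset_univ]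
    rw [pow_succ, Module.End.mul_apply, ih, sum_fin_cons]
    simp only [monodromy_L2_one_apply, hcol, Fin.prod_univ_succ, Fin.cons_zero, Fin.cons_succ,
      Finset.prod_mul_distrib, Finset.mul_sum, Finset.sum_mul, ← Fintype.sum_prod_type']
    refine Fintype.sum_equiv ⟨fun ⟨f, σ, τ, r⟩ => ⟨r, f, τ, σ⟩, fun ⟨r, f, τ, σ⟩ => ⟨f, σ, τ, r⟩,
      fun _ => rfl, fun _ => rfl⟩ _ _ fun ⟨f, σ, τ, r⟩ => ?_
    simp only [Equiv.coe_fn_mk, show Fin.rev (1 : Fin 2) = 0 from rfl]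
    ring

end Anis

end RowWeights

/-! ### The generating polynomial -/

section Weights

variable {n : ℕ}

lemma confinedInd_zero_eq (f : Fin n → Fin 3) [Decidable (Confined 0 fun j => entry (f j))] :
    confinedInd 0 f = if Confined 0 (fun j => entry (f j)) then 1 else 0 := by
  simp [confinedInd]

lemma entryWeight_eq {u : ℝ} (hu : u ≠ 0) (a : Fin 3) :
    entryWeight u a = u ^ entry a * if entry a = -1 then u ^ 2 else 1 := by
  fin_cases a <;> simp [entryWeight]
  field_simp

lemma prod_entryWeight {ι : Type*} [Fintype ι] {u : ℝ} (hu : u ≠ 0) (f : ι → Fin 3) :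
    ∏ i, entryWeight u (f i) =
      u ^ (∑ i, entry (f i)) * (u ^ 2) ^ (univ.filter fun i => entry (f i) = -1).card := by
  have h : ∀ s : Finset ι, ∏ i ∈ s, u ^ entry (f i) = u ^ ∑ i ∈ s, entry (f i) := by
    classical
    intro s
    induction s using Finset.induction with
    | empty => simp
    | insert a s ha ih => rw [Finset.prod_insert ha, Finset.sum_insert ha, ih, zpow_add₀ hu]
  simp only [entryWeight_eq hu, Finset.prod_mul_distrib, h, Finset.prod_ite, Finset.prod_const,
    one_pow, mul_one]

/-- At the combinatorial point, the six-vertex partition function enumerates alternating sign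
matrices. -/
lemma Anis.cov_mB_L2_pow_vac (Δ : Anis) :
    cov 1 n ((mB Δ.L2 (1 : Fin n → ℝ) 1 ^ n) (vac 0 n)) =
      Δ.c ^ n ^ 2 * ((Δ.q + Δ.p) ^ n * aeval ((Δ.q + Δ.p) ^ 2) (asmPoly n)) := by
  classical
  have hu : Δ.q + Δ.p ≠ 0 := by
    rw [← Δ.y_sq]
    exact pow_ne_zero 2 Δ.y_pos.ne'
  have hτ : ∀ g : (Fin n → Fin 2) → ℝ, ∑ τ, g τ * vac 0 n τ = g fun _ => 0 := by
    intro g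
    simp [vac, Pi.single_apply]
  rw [Δ.cov_mB_L2_pow, ← sq, asmPoly, map_sum (aeval _), Finset.sum_filter]
  congr 1
  rw [Finset.mul_sum]
  refine Finset.sum_congr rfl fun f _ => ?_
  rw [hτ]
  simp only [confinedInd_zero_eq, Finset.prod_ite_zero,
    Finset.prod_const_one, Finset.mem_univ, true_imp_iff, ite_mul, mul_ite, one_mul, zero_mul,
    mul_one, mul_zero, ← ite_and, map_pow, aeval_X]
  refine ite_congr (propext (and_comm.trans (isASM_toMat_iff f).symm)) (fun h => ?_) fun _ => rfl
  have hsum : ∑ p : Fin n × Fin n, entry (f p.1 p.2) = n := by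
    rw [Fintype.sum_prod_type]
    exact (Finset.sum_congr rfl fun i _ => h.2.1 i).trans (by simp)
  have := prod_entryWeight hu fun p : Fin n × Fin n => f p.1 p.2
  rw [hsum, zpow_natCast, Fintype.prod_prod_type] at this
  rw [this]
  rfl

end Weights

namespace Anis

variable (Δ : Anis) {N : ℕ}

lemma sum_aeval_sq {P : (Fin N → Fin 3) → Polynomial ℤ}
    (hP : ∀ τ, _root_.comp N τ = X ^ N * (P τ).comp (X ^ 2)) :
    aeval (Δ.y ^ 2) (∑ τ, P τ ^ 2) = aeval (Δ.y ^ 2) ((asmPoly N).comp (X ^ 2)) := by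
  have h := Δ.sum_homSinglet_sq (n := N)
  simp only [cov_mB_L2_pow_vac, homSinglet_apply, hP, ← Δ.y_sq, map_mul, map_pow, aeval_X,
    aeval_comp, mul_pow, ← Finset.mul_sum] at h
  have hc : Δ.c ^ N ^ 2 ≠ 0 := pow_ne_zero _ Δ.c_pos.ne'
  have hy : (Δ.y ^ 2) ^ N ≠ 0 := pow_ne_zero _ (pow_ne_zero _ Δ.y_pos.ne')
  simp only [map_sum, map_pow, aeval_comp, aeval_X]
  refine mul_left_cancel₀ (mul_ne_zero (mul_ne_zero hc hc) hy) ?_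
  linear_combination h

/-- The anisotropy with `q` a given number larger than one. -/
def ofOneLt (q : ℝ) (hq : 1 < q) : Anis where
  q := q
  p := q⁻¹
  y := √(q + q⁻¹)
  one_lt := hq
  q_mul_p := mul_inv_cancel₀ (by positivity)
  y_pos := by positivity
  y_sq := Real.sq_sqrt (by positivity)

end Anis

lemma Polynomial.eq_of_aeval_anis {f g : Polynomial ℤ}
    (h : ∀ Δ : Anis, aeval (Δ.y ^ 2) f = aeval (Δ.y ^ 2) g) : f = g := by
  refine Polynomial.map_injective (algebraMap ℤ ℝ) (RingHom.injective_int _) ?_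
  refine Polynomial.eq_of_infinite_eval_eq _ _ ?_
  refine Set.Infinite.mono (s := Set.image (fun q : ℝ => q + q⁻¹) (Set.Ioi 1)) ?_ ?_
  · rintro _ ⟨q, hq, rfl⟩
    have := h (Anis.ofOneLt q hq)
    rw [(Anis.ofOneLt q hq).y_sq] at this
    simpa only [aeval_def, Set.mem_ofPred_eq, eval_map] using! this
  · refine (Set.Ioi_infinite (1 : ℝ)).image ?_
    intro a (ha : 1 < a) b (hb : 1 < b) hab
    have ha0 : a ≠ 0 := by positivity
    have hb0 : b ≠ 0 := by positivity
    have key : (a - b) * (a * b - 1) = 0 := by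
      simp only at hab
      field_simp at hab
      linear_combination hab
    have : a * b - 1 ≠ 0 := by nlinarith
    exact sub_eq_zero.1 ((mul_eq_zero.1 key).resolve_right this)

/-- Square-norm sum rule: `∑_τ P_τ(X)² = A_N(X²)` in ℤ[X], where the `P_τ` are the
polynomials with `⟨τ|β^N|∧⟩ = y^N · P_τ(y²)`. -/
theorem stmt1 (N : ℕ) (hN : 1 ≤ N) (P : (Fin N → Fin 3) → Polynomial ℤ)
    (hP : ∀ τ, comp N τ = Polynomial.X ^ N * (P τ).comp (Polynomial.X ^ 2)) :
    ∑ τ : Fin N → Fin 3, (P τ) ^ 2 = (asmPoly N).comp (Polynomial.X ^ 2) := by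
  exact Polynomial.eq_of_aeval_anis fun Δ => Δ.sum_aeval_sq hP

end
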